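/- For every η > 0 there exists a constant C > 0 such that the following holds. Let P ⊆ ℝ² be a set of n points with |Δ(P)| ≤ n/5, let ℓ be the x-axis, and suppose P_1 = ℓ ∩ P has |P_1| = m ≥ n^{4/5}. Then for every line ℓ′ orthogonal to ℓ, the number k = |ℓ′ ∩ P| satisfies k ≤ C·( n^{25/4 + 8η} / m^{7} + n/m ). -/

import Mathlib

open Finset

/-- Euclidean distance between two points of `ℝ²`. -/
noncomputable def edist2 (p q : ℝ × ℝ) : ℝ :=
  Real.sqrt ((p.1 - q.1) ^ 2 + (p.2 - q.2) ^ 2)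

/-- The number of distinct distances within a finite point set in `ℝ²`. -/
noncomputable def distSet (P : Finset (ℝ × ℝ)) : ℕ :=
  ({x : ℝ | ∃ p ∈ P, ∃ q ∈ P, x = edist2 p q}).ncard

set_option linter.all false

lemma psd_sum {α β : Type*} [DecidableEq β] (s : Finset α) (κ : α → β) (f : α → ℤ) :
    0 ≤ ∑ a ∈ s, ∑ b ∈ s, (if κ a = κ b then f a * f b else 0) := by
  classical
  have h : ∑ a ∈ s, ∑ b ∈ s, (if κ a = κ b then f a * f b else 0)
      = ∑ w ∈ s.image κ, (∑ a ∈ s, if κ a = w then f a else 0) ^ 2 := by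
    simp_rw [sq, Finset.sum_mul_sum]
    rw [Finset.sum_comm' (t' := s) (s' := fun _ => s.image κ) (by simp [and_comm])]
    refine Finset.sum_congr rfl fun a ha => ?_
    rw [Finset.sum_comm]
    refine Finset.sum_congr rfl fun b hb => ?_
    rw [Finset.sum_eq_single (κ a)]
    · by_cases h : κ b = κ a
      · simp [h]
      · simp [h, Ne.symm h]
    · intro w _ hw
      simp [Ne.symm hw]
    · intro h
      exact absurd (Finset.mem_image_of_mem κ ha) h
  rw [h]
  exact Finset.sum_nonneg fun _ _ => sq_nonneg _

lemma card_sq_le_pairs {α β : Type*} [DecidableEq β] (s : Finset α) (t : Finset β) (κ : α → β)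
    (h : ∀ a ∈ s, κ a ∈ t) :
    s.card ^ 2 ≤ t.card * ((s ×ˢ s).filter (fun p => κ p.1 = κ p.2)).card := by
  classical
  have h1 : ((s ×ˢ s).filter (fun p => κ p.1 = κ p.2)).card
      = ∑ b ∈ t, (s.filter (fun a => κ a = b)).card ^ 2 := by
    rw [Finset.card_eq_sum_card_fiberwise (f := fun p : α × α => κ p.1) (t := t)]
    · refine Finset.sum_congr rfl fun b hb => ?_
      rw [sq, ← Finset.card_product]
      congr 1
      ext ⟨x, y⟩
      simp only [mem_filter, mem_product]
      constructor
      · rintro ⟨⟨⟨h1, h2⟩, h3⟩, h4⟩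
        exact ⟨⟨h1, h4⟩, h2, h3 ▸ h4⟩
      · rintro ⟨⟨h1, h2⟩, h3, h4⟩
        exact ⟨⟨⟨h1, h3⟩, h2.trans h4.symm⟩, h2⟩
    · intro p hp
      simp only [coe_filter, mem_product, Set.mem_ofPred_eq] at hp
      exact h _ hp.1.1
  rw [h1, Finset.card_eq_sum_card_fiberwise (f := κ) (t := t) h]
  exact sq_sum_le_card_mul_sum_sq

/-- existence of the separating level -/
lemma exists_level (d x y : ℕ) (hx : x < 2 ^ d) (hy : y < 2 ^ d) (hne : x ≠ y) :
    ∃ l < d, x / 2 ^ l ≠ y / 2 ^ l ∧ x / 2 ^ l / 2 = y / 2 ^ l / 2 := by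
  classical
  have hex : ∃ l, x / 2 ^ l = y / 2 ^ l := ⟨d, by rw [Nat.div_eq_of_lt hx, Nat.div_eq_of_lt hy]⟩
  have h0 : Nat.find hex ≠ 0 := by
    intro h
    have := Nat.find_spec hex
    rw [h] at this
    simp at this
    exact hne this
  obtain ⟨l, hl⟩ := Nat.exists_eq_succ_of_ne_zero h0
  refine ⟨l, ?_, Nat.find_min hex (by omega), ?_⟩
  · have : Nat.find hex ≤ d := Nat.find_le (by rw [Nat.div_eq_of_lt hx, Nat.div_eq_of_lt hy])
    omega
  · have := Nat.find_spec hex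
    rw [hl, Nat.succ_eq_add_one, pow_succ] at this
    rwa [Nat.div_div_eq_div_mul, Nat.div_div_eq_div_mul]

section core
variable {ι : Type*} [Fintype ι] [DecidableEq ι]

/-- reversal structure -/
structure RevRel (L : ι → ι → Prop) (r : ι → ι → ℕ) (d : ℕ) : Prop where
  lt : ∀ i j, L i j → r i j < 2 ^ d
  row : ∀ i j j', L i j → L i j' → r i j = r i j' → j = j'
  col : ∀ i i' j, L i j → L i' j → r i j = r i' j → i = i'
  rev : ∀ i i' j j', L i j → L i' j → L i j' → L i' j' → r i j < r i' j → r i j' < r i' j' →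
    r i j < r i j' → r i' j < r i' j' → False

lemma RevRel.transpose {L : ι → ι → Prop} {r : ι → ι → ℕ} {d : ℕ} (h : RevRel L r d) :
    RevRel (fun i j => L j i) (fun i j => r j i) d where
  lt i j hl := h.lt _ _ hl
  row i j j' h1 h2 h3 := h.col _ _ _ h1 h2 h3
  col i i' j h1 h2 h3 := h.row _ _ _ h1 h2 h3
  rev i i' j j' h1 h2 h3 h4 h5 h6 h7 h8 := h.rev _ _ _ _ h1 h3 h2 h4 h7 h8 h5 h6

open Classical in
/-- pair count at a level -/
noncomputable def Nlev (L : ι → ι → Prop) (r : ι → ι → ℕ) (l : ℕ) (i i' : ι) : Finset (ι × ι) :=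
  Finset.univ.filter (fun p => L i p.1 ∧ L i' p.1 ∧ L i p.2 ∧ L i' p.2 ∧
    r i p.1 / 2 ^ l = r i p.2 / 2 ^ l ∧ r i' p.1 / 2 ^ l = r i' p.2 / 2 ^ l ∧
    r i p.1 / 2 ^ l ≠ r i' p.1 / 2 ^ l ∧ r i p.1 / 2 ^ l / 2 = r i' p.1 / 2 ^ l / 2)

open Classical in
noncomputable def Com (L : ι → ι → Prop) (i i' : ι) : Finset ι :=
  Finset.univ.filter (fun j => L i j ∧ L i' j)

open Classical in
noncomputable def asg (L : ι → ι → Prop) (r : ι → ι → ℕ) (l : ℕ) (i j j' : ι) : ℤ :=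
  if L i j ∧ L i j' ∧ r i j / 2 ^ l = r i j' / 2 ^ l then
    (if r i j < r i j' then 1 else if r i j' < r i j then -1 else 0) else 0

lemma com_sq_le {L : ι → ι → Prop} {r : ι → ι → ℕ} {d : ℕ} (h : RevRel L r d) (i i' : ι)
    (hi : i ≠ i') : (Com L i i').card ^ 2 ≤ 2 * d * ∑ l ∈ range d, (Nlev L r l i i').card := by
  classical
  have hlev : ∀ j, ∃ l, j ∈ Com L i i' → (l < d ∧ r i j / 2 ^ l ≠ r i' j / 2 ^ l ∧
      r i j / 2 ^ l / 2 = r i' j / 2 ^ l / 2) := by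
    intro j
    by_cases hj : j ∈ Com L i i'
    · have hj' := hj
      simp only [Com, mem_filter, mem_univ, true_and] at hj'
      obtain ⟨l, h1, h2, h3⟩ := exists_level d (r i j) (r i' j) (h.lt _ _ hj'.1) (h.lt _ _ hj'.2)
        (fun he => hi (h.col _ _ _ hj'.1 hj'.2 he))
      exact ⟨l, fun _ => ⟨h1, h2, h3⟩⟩
    · exact ⟨0, fun h => absurd h hj⟩
  choose lev hlev using hlev
  have h1 := card_sq_le_pairs (Com L i i') (range d ×ˢ (univ : Finset Bool))
    (fun j => (lev j, decide (r i j < r i' j))) (by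
      intro a ha
      simp [(hlev a ha).1, lt_or_ge])
  refine h1.trans ?_
  rw [card_product, card_range, card_univ, Fintype.card_bool, mul_comm d 2]
  refine Nat.mul_le_mul_left _ ?_
  rw [Finset.card_eq_sum_card_fiberwise (f := fun p : ι × ι => lev p.1) (t := range d)]
  · refine Finset.sum_le_sum fun l hl => Finset.card_le_card ?_
    rintro ⟨j, j'⟩ hp
    simp only [mem_filter, mem_product, Prod.mk.injEq, decide_eq_decide] at hp
    obtain ⟨⟨⟨hj, hj'⟩, hlv, hty⟩, rfl⟩ := hp
    have a1 := hlev j hj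
    have a2 := hlev j' hj'
    rw [← hlv] at a2
    simp only [Com, mem_filter, mem_univ, true_and] at hj hj'
    obtain ⟨-, b1, b2⟩ := a1
    obtain ⟨-, c1, c2⟩ := a2
    simp only [Nlev, mem_filter, mem_univ, true_and]
    have key : ∀ x y : ℕ, x / 2 ^ lev j < y / 2 ^ lev j → x < y := by
      intro x y hxy
      by_contra hh
      exact absurd (Nat.div_le_div_right (c := 2 ^ lev j) (not_lt.1 hh)) (not_le.2 hxy)
    have key2 : ∀ x y : ℕ, x < y → x / 2 ^ lev j ≤ y / 2 ^ lev j := fun x y hxy =>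
      Nat.div_le_div_right hxy.le
    refine ⟨hj.1, hj.2, hj'.1, hj'.2, ?_⟩
    have r1 := h.rev i i' j j' hj.1 hj.2 hj'.1 hj'.2
    have r2 := h.rev i i' j' j hj'.1 hj'.2 hj.1 hj.2
    have r3 := h.rev i' i j j' hj.2 hj.1 hj'.2 hj'.1
    have r4 := h.rev i' i j' j hj'.2 hj'.1 hj.2 hj.1
    have k1 := key (r i j) (r i j')
    have k2 := key (r i' j) (r i' j')
    have k3 := key (r i j') (r i j)
    have k4 := key (r i' j') (r i' j)
    have m1 := key2 (r i j) (r i' j)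
    have m2 := key2 (r i' j) (r i j)
    have m3 := key2 (r i j') (r i' j')
    have m4 := key2 (r i' j') (r i j')
    have n1 : r i j ≠ r i' j := fun he => b1 (by rw [he])
    have n2 : r i j' ≠ r i' j' := fun he => c1 (by rw [he])
    generalize r i j / 2 ^ lev j = A at *
    generalize r i' j / 2 ^ lev j = B at *
    generalize r i j' / 2 ^ lev j = C at *
    generalize r i' j' / 2 ^ lev j = E at *
    rcases lt_or_gt_of_ne n1 with n1 | n1
    · have n2' := hty.1 n1
      have := m1 n1
      have := m3 n2'
      rcases lt_trichotomy (A / 2) (C / 2) with q | q | q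
      · exact (r1 n1 n2' (k1 (by omega)) (k2 (by omega))).elim
      · omega
      · exact (r2 n2' n1 (k3 (by omega)) (k4 (by omega))).elim
    · have n2' : r i' j' < r i j' := by
        rcases lt_or_gt_of_ne n2 with q | q
        · have := hty.2 q; omega
        · exact q
      have := m2 n1
      have := m4 n2'
      rcases lt_trichotomy (A / 2) (C / 2) with q | q | q
      · exact (r3 n1 n2' (k2 (by omega)) (k1 (by omega))).elim
      · omega
      · exact (r4 n2' n1 (k4 (by omega)) (k3 (by omega))).elim
  · rintro ⟨j, j'⟩ hp
    simp only [coe_filter, mem_product, Set.mem_ofPred_eq] at hp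
    simpa using (hlev j hp.1.1).1

end core

section core2
variable {ι : Type*} [Fintype ι] [DecidableEq ι]

lemma asg_ne {L : ι → ι → Prop} {r : ι → ι → ℕ} {l : ℕ} {i j j' : ι} (h : asg L r l i j j' ≠ 0) :
    L i j ∧ L i j' := by
  classical
  by_contra hh
  exact h (by rw [asg, if_neg (by tauto)])

lemma sign_arith (a b c e A B C E : ℕ) (n1 : a ≠ c) (n2 : b ≠ e) (n3 : a ≠ b) (n4 : c ≠ e)
    (r1 : a < b → c < e → a < c → b < e → False)
    (r2 : c < e → a < b → c < a → e < b → False)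
    (r3 : b < a → e < c → b < e → a < c → False)
    (r4 : e < c → b < a → e < b → c < a → False)
    (k1 : A < B → a < b) (k2 : B < A → b < a) (k3 : C < E → c < e) (k4 : E < C → e < c) :
    (if A / 2 = B / 2 then
        (if A = C then (if a < c then (1:ℤ) else if c < a then -1 else 0) else 0) *
          (if B = E then (if b < e then (1:ℤ) else if e < b then -1 else 0) else 0) else 0) +
      (if A = C ∧ B = E ∧ A ≠ B ∧ A / 2 = B / 2 then 1 else 0) +
      (if A = B ∧ C = E ∧ A = C then (if a < b then (1:ℤ) else -1) * (if c < e then 1 else -1)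
        else 0) ≤ 0 := by
  replace r1 : ¬ (a < b ∧ c < e ∧ a < c ∧ b < e) := fun h => r1 h.1 h.2.1 h.2.2.1 h.2.2.2
  replace r2 : ¬ (c < e ∧ a < b ∧ c < a ∧ e < b) := fun h => r2 h.1 h.2.1 h.2.2.1 h.2.2.2
  replace r3 : ¬ (b < a ∧ e < c ∧ b < e ∧ a < c) := fun h => r3 h.1 h.2.1 h.2.2.1 h.2.2.2
  replace r4 : ¬ (e < c ∧ b < a ∧ e < b ∧ c < a) := fun h => r4 h.1 h.2.1 h.2.2.1 h.2.2.2
  by_cases hAC : A = C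
  swap
  · simp [hAC]
  by_cases hBE : B = E
  swap
  · have : ¬ (A = B ∧ C = E ∧ A = C) := by rintro ⟨rfl, rfl, h⟩; exact hBE h
    simp [hBE, this]
  subst hAC hBE
  by_cases hAB : A = B
  · subst hAB
    simp only [if_true, true_and, ne_eq, not_true_eq_false, false_and, if_false, and_self]
    rcases lt_or_gt_of_ne n1 with n1 | n1 <;> rcases lt_or_gt_of_ne n2 with n2 | n2 <;>
    rcases lt_or_gt_of_ne n3 with n3 | n3 <;> rcases lt_or_gt_of_ne n4 with n4 | n4 <;>
    simp only [n1, n2, n3, n4, not_lt_of_gt n1, not_lt_of_gt n2, not_lt_of_gt n3,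
        not_lt_of_gt n4, if_true, if_false] <;> first | omega | norm_num
  · simp only [hAB, if_true, true_and, false_and, if_false, ne_eq, not_false_eq_true]
    rcases lt_or_gt_of_ne hAB with q | q
    · have := k1 q
      have := k3 q
      split_ifs <;> first | omega | norm_num
    · have := k2 q
      have := k4 q
      split_ifs <;> first | omega | norm_num

lemma level_pair {L : ι → ι → Prop} {r : ι → ι → ℕ} {d : ℕ} (h : RevRel L r d) (l : ℕ) (i i' : ι)
    (hi : i ≠ i') :
    ∑ j, ∑ j', (if r i j / 2 ^ l / 2 = r i' j / 2 ^ l / 2 then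
        asg L r l i j j' * asg L r l i' j j' else 0) + ((Nlev L r l i i').card : ℤ)
      ≤ ((Com L i i').card : ℤ) := by
  classical
  -- the sign
  let ε : ι → ℤ := fun j => if r i j < r i' j then 1 else -1
  let cc : ι → Prop := fun j => L i j ∧ L i' j
  have hε : ∀ j, ε j * ε j = 1 := by
    intro j; simp only [ε]; split_ifs <;> norm_num
  -- psd on the diagonal pieces
  have hpsd := psd_sum (univ.filter (fun j => cc j ∧ r i j / 2 ^ l = r i' j / 2 ^ l))
    (fun j => r i j / 2 ^ l) ε
  simp only [sum_filter] at hpsd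
  have hN : ((Nlev L r l i i').card : ℤ) = ∑ j, ∑ j', (if (cc j ∧ cc j' ∧
      r i j / 2 ^ l = r i j' / 2 ^ l ∧ r i' j / 2 ^ l = r i' j' / 2 ^ l ∧
      r i j / 2 ^ l ≠ r i' j / 2 ^ l ∧ r i j / 2 ^ l / 2 = r i' j / 2 ^ l / 2) then 1 else 0) := by
    rw [Nlev, ← Finset.sum_product', Finset.univ_product_univ, Finset.card_filter]
    push_cast
    refine Finset.sum_congr rfl fun p _ => ?_
    congr 1
    simp only [cc, eq_iff_iff]
    tauto
  have hC : ((Com L i i').card : ℤ) = ∑ j, ∑ j', (if j = j' ∧ cc j then 1 else 0) := by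
    rw [Com, Finset.card_filter]
    push_cast
    refine Finset.sum_congr rfl fun j _ => ?_
    rw [Finset.sum_eq_single j]
    · simp [cc]
    · intro b _ hb; simp [Ne.symm hb]
    · simp
  have key : ∑ j, ∑ j', (if r i j / 2 ^ l / 2 = r i' j / 2 ^ l / 2 then
        asg L r l i j j' * asg L r l i' j j' else 0) + ((Nlev L r l i i').card : ℤ)
      + (∑ a, if cc a ∧ r i a / 2 ^ l = r i' a / 2 ^ l then
          (∑ b, if cc b ∧ r i b / 2 ^ l = r i' b / 2 ^ l then
            (if r i a / 2 ^ l = r i b / 2 ^ l then ε a * ε b else 0) else 0) else 0)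
      ≤ ((Com L i i').card : ℤ) := by
    rw [hN, hC, ← Finset.sum_add_distrib, ← Finset.sum_add_distrib]
    refine Finset.sum_le_sum fun j _ => ?_
    have : (if cc j ∧ r i j / 2 ^ l = r i' j / 2 ^ l then
          (∑ b, if cc b ∧ r i b / 2 ^ l = r i' b / 2 ^ l then
            (if r i j / 2 ^ l = r i b / 2 ^ l then ε j * ε b else 0) else 0) else 0)
        = ∑ b, (if cc j ∧ r i j / 2 ^ l = r i' j / 2 ^ l ∧ cc b ∧ r i b / 2 ^ l = r i' b / 2 ^ l ∧
            r i j / 2 ^ l = r i b / 2 ^ l then ε j * ε b else 0) := by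
      split_ifs with h1
      · refine Finset.sum_congr rfl fun b _ => ?_
        simp only [h1, true_and]
        split_ifs <;> tauto
      · symm
        apply Finset.sum_eq_zero
        intro b _
        rw [if_neg (by tauto)]
    rw [this, ← Finset.sum_add_distrib, ← Finset.sum_add_distrib]
    refine Finset.sum_le_sum fun j' _ => ?_
    by_cases hcc : cc j ∧ cc j'
    swap
    · have h1 : asg L r l i j j' * asg L r l i' j j' = 0 := by
        by_contra hne
        exact hcc ⟨⟨(asg_ne (left_ne_zero_of_mul hne)).1, (asg_ne (right_ne_zero_of_mul hne)).1⟩,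
          (asg_ne (left_ne_zero_of_mul hne)).2, (asg_ne (right_ne_zero_of_mul hne)).2⟩
      rw [h1, ite_self, if_neg (fun hh => hcc ⟨hh.1, hh.2.1⟩),
        if_neg (fun hh => hcc ⟨hh.1, hh.2.2.1⟩)]
      split_ifs <;> norm_num
    obtain ⟨⟨hj1, hj2⟩, hj1', hj2'⟩ := hcc
    by_cases hjj : j = j'
    · subst hjj
      have h1 : asg L r l i j j = 0 := by simp [asg]
      rw [h1]
      have := hε j
      simp only [cc, hj1, hj2, zero_mul, ite_self, true_and, and_true, this]
      split_ifs <;> simp_all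
    · have n1 : r i j ≠ r i j' := fun he => hjj (h.row _ _ _ hj1 hj1' he)
      have n2 : r i' j ≠ r i' j' := fun he => hjj (h.row _ _ _ hj2 hj2' he)
      have n3 : r i j ≠ r i' j := fun he => hi (h.col _ _ _ hj1 hj2 he)
      have n4 : r i j' ≠ r i' j' := fun he => hi (h.col _ _ _ hj1' hj2' he)
      have r1 := h.rev i i' j j' hj1 hj2 hj1' hj2'
      have r2 := h.rev i i' j' j hj1' hj2' hj1 hj2
      have r3 := h.rev i' i j j' hj2 hj1 hj2' hj1'
      have r4 := h.rev i' i j' j hj2' hj1' hj2 hj1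
      have key2 : ∀ x y : ℕ, x / 2 ^ l < y / 2 ^ l → x < y := by
        intro x y hxy
        by_contra hh
        exact absurd (Nat.div_le_div_right (c := 2 ^ l) (not_lt.1 hh)) (not_le.2 hxy)
      have k1 := key2 (r i j) (r i' j)
      have k2 := key2 (r i' j) (r i j)
      have k3 := key2 (r i j') (r i' j')
      have k4 := key2 (r i' j') (r i j')
      simp only [asg, cc, hj1, hj2, hj1', hj2', true_and, hjj, false_and, if_false, ε]
      exact sign_arith _ _ _ _ _ _ _ _ n1 n2 n3 n4 r1 r2 r3 r4 k1 k2 k3 k4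
  linarith

end core2

section core3
variable {ι : Type*} [Fintype ι] [DecidableEq ι]

open Classical in
noncomputable def li (L : ι → ι → Prop) (i j : ι) : ℤ := if L i j then 1 else 0

lemma li_sq (L : ι → ι → Prop) (i j : ι) : li L i j * li L i j = li L i j := by
  unfold li; split_ifs <;> norm_num

lemma com_eq (L : ι → ι → Prop) (i i' : ι) : ((Com L i i').card : ℤ) = ∑ j, li L i j * li L i' j := by
  classical
  rw [Com, Finset.card_filter]
  push_cast
  refine Finset.sum_congr rfl fun j _ => ?_
  unfold li
  split_ifs <;> simp_all

lemma sum_com (L : ι → ι → Prop) :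
    ∑ i, ∑ i', ((Com L i i').card : ℤ) = ∑ j, (∑ i, li L i j) ^ 2 := by
  simp_rw [com_eq, sq, Finset.sum_mul_sum]
  rw [Finset.sum_comm' (t' := univ) (s' := fun _ => univ) (by simp)]
  rw [Finset.sum_comm]
  rw [Finset.sum_comm' (t' := univ) (s' := fun _ => univ) (by simp)]
  have : ∀ x : ι, ∑ i, ∑ j, li L i j * li L x j = ∑ j, ∑ i, li L i j * li L x j := by
    intro x; rw [Finset.sum_comm]
  simp_rw [this]
  rw [Finset.sum_comm]
  refine Finset.sum_congr rfl fun j _ => ?_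
  rw [Finset.sum_comm]

lemma level_sum {L : ι → ι → Prop} {r : ι → ι → ℕ} {d : ℕ} (h : RevRel L r d) (l : ℕ) :
    ∑ i, ∑ i', ((Nlev L r l i i').card : ℤ)
      ≤ ∑ i, (∑ j, li L i j) ^ 2 + ∑ j, (∑ i, li L i j) ^ 2 := by
  classical
  let G : ι → ι → ℤ := fun i i' => ∑ j, ∑ j', (if r i j / 2 ^ l / 2 = r i' j / 2 ^ l / 2 then
        asg L r l i j j' * asg L r l i' j j' else 0)
  have hG : 0 ≤ ∑ i, ∑ i', G i i' := by
    have e : ∑ i, ∑ i', G i i' = ∑ j, ∑ j', ∑ i, ∑ i', (if r i j / 2 ^ l / 2 = r i' j / 2 ^ l / 2 then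
        asg L r l i j j' * asg L r l i' j j' else 0) := by
      simp only [G]
      have e1 : ∀ i, ∑ i', ∑ j, ∑ j', (if r i j / 2 ^ l / 2 = r i' j / 2 ^ l / 2 then
        asg L r l i j j' * asg L r l i' j j' else 0) = ∑ j, ∑ j', ∑ i',
        (if r i j / 2 ^ l / 2 = r i' j / 2 ^ l / 2 then
        asg L r l i j j' * asg L r l i' j j' else 0) := by
        intro i
        rw [Finset.sum_comm]
        refine Finset.sum_congr rfl fun j _ => ?_
        rw [Finset.sum_comm]
      simp_rw [e1]
      rw [Finset.sum_comm]
      refine Finset.sum_congr rfl fun j _ => ?_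
      rw [Finset.sum_comm]
    rw [e]
    refine Finset.sum_nonneg fun j _ => Finset.sum_nonneg fun j' _ => ?_
    exact psd_sum univ (fun i => r i j / 2 ^ l / 2) (fun i => asg L r l i j j')
  have hp : ∀ i i', ((Nlev L r l i i').card : ℤ) ≤ - G i i' + ((Com L i i').card : ℤ) +
      (if i = i' then (∑ j, li L i j) ^ 2 else 0) := by
    intro i i'
    by_cases hi : i = i'
    · subst hi
      have h0 : Nlev L r l i i = ∅ := by
        apply Finset.filter_eq_empty_iff.2
        intro p _ hp
        exact hp.2.2.2.2.2.2.1 rfl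
      have h1 : G i i ≤ (∑ j, li L i j) ^ 2 := by
        rw [sq, Finset.sum_mul_sum]
        refine Finset.sum_le_sum fun j _ => Finset.sum_le_sum fun j' _ => ?_
        unfold asg li
        split_ifs <;> simp_all
      rw [h0]
      simp
      have : (0:ℤ) ≤ ((Com L i i).card : ℤ) := by positivity
      linarith
    · have := level_pair h l i i' hi
      simp only [hi, if_false, G]
      linarith
  have := Finset.sum_le_sum (s := univ) fun i _ => Finset.sum_le_sum (s := univ) fun i' _ => hp i i'
  refine this.trans ?_
  simp only [Finset.sum_add_distrib, Finset.sum_neg_distrib, Finset.sum_ite_eq, mem_univ, if_true]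
  rw [sum_com]
  linarith

lemma core_claim {L : ι → ι → Prop} {r : ι → ι → ℕ} {d : ℕ} (h : RevRel L r d) :
    (∑ j, (∑ i, li L i j) ^ 2 - ∑ i, ∑ j, li L i j) ^ 2 ≤ (Fintype.card ι : ℤ) ^ 2 *
      (2 * d ^ 2 * (∑ i, (∑ j, li L i j) ^ 2 + ∑ j, (∑ i, li L i j) ^ 2)) := by
  classical
  set D := (∑ i, (∑ j, li L i j) ^ 2 + ∑ j, (∑ i, li L i j) ^ 2) with hD
  let c' : ι × ι → ℤ := fun p => if p.1 = p.2 then 0 else ((Com L p.1 p.2).card : ℤ)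
  have h1 : ∑ p, c' p = ∑ j, (∑ i, li L i j) ^ 2 - ∑ i, ∑ j, li L i j := by
    rw [← sum_com, ← Finset.univ_product_univ, Finset.sum_product, ← Finset.sum_sub_distrib]
    refine Finset.sum_congr rfl fun i _ => ?_
    have : ∑ j, li L i j = ((Com L i i).card : ℤ) := by
      rw [com_eq]; simp_rw [li_sq]
    rw [this, eq_sub_iff_add_eq]
    have e2 : ((Com L i i).card : ℤ) = ∑ y, (if i = y then ((Com L i y).card : ℤ) else 0) := by
      simp
    rw [e2, ← Finset.sum_add_distrib]
    refine Finset.sum_congr rfl fun y _ => ?_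
    simp only [c']
    split_ifs <;> simp
  have h2 : ∑ p, c' p ^ 2 ≤ 2 * d ^ 2 * D := by
    have : ∀ p : ι × ι, c' p ^ 2 ≤ 2 * d * ∑ l ∈ range d, ((Nlev L r l p.1 p.2).card : ℤ) := by
      rintro ⟨i, i'⟩
      have hnn : (0:ℤ) ≤ 2 * d * ∑ l ∈ range d, ((Nlev L r l i i').card : ℤ) :=
        mul_nonneg (by positivity) (Finset.sum_nonneg fun _ _ => by positivity)
      by_cases hi : i = i'
      · have : c' (i, i') = 0 := if_pos hi
        rw [this]
        simpa using hnn
      · have : c' (i, i') = ((Com L i i').card : ℤ) := if_neg hi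
        rw [this]
        have := com_sq_le h i i' hi
        have h2 : (((Com L i i').card ^ 2 : ℕ) : ℤ) ≤ ((2 * d * ∑ l ∈ range d, (Nlev L r l i i').card : ℕ) : ℤ) := Int.ofNat_le.2 this
        push_cast at h2
        exact h2
    refine (Finset.sum_le_sum fun p _ => this p).trans ?_
    rw [← Finset.mul_sum, Finset.sum_comm]
    have : ∀ l ∈ range d, ∑ p : ι × ι, ((Nlev L r l p.1 p.2).card : ℤ) ≤ D := by
      intro l _
      rw [← Finset.univ_product_univ, Finset.sum_product]
      exact level_sum h l
    have h3 := Finset.sum_le_sum this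
    rw [Finset.sum_const, card_range, nsmul_eq_mul] at h3
    calc _ ≤ 2 * (d:ℤ) * (d * D) := by gcongr
      _ = _ := by ring
  rw [← h1]
  refine (sq_sum_le_card_mul_sum_sq (s := univ) (f := c')).trans ?_
  rw [Finset.card_univ, Fintype.card_prod]
  push_cast
  rw [← sq]
  gcongr

theorem core_order {L : ι → ι → Prop} {r : ι → ι → ℕ} {d : ℕ} (h : RevRel L r d) (N : ℤ)
    (hN : N = ∑ i, ∑ j, li L i j) :
    N ≤ 2 * (Fintype.card ι : ℤ) ∨ N ^ 2 ≤ 16 * (Fintype.card ι : ℤ) ^ 3 * d ^ 2 := by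
  classical
  have c1 := core_claim h
  have c2 := core_claim h.transpose
  have t : ∀ i j, li (fun i j => L j i) i j = li L j i := fun i j => rfl
  simp only [t] at c2
  rw [Finset.sum_comm (f := fun i j => li L j i)] at c2
  rw [← hN] at c1 c2
  have s1 := sq_sum_le_card_mul_sum_sq (s := univ) (f := fun i => ∑ j, li L i j)
  have s2 := sq_sum_le_card_mul_sum_sq (s := univ) (f := fun j => ∑ i, li L i j)
  rw [Finset.sum_comm] at s2
  rw [← hN, Finset.card_univ] at s1 s2
  set c : ℤ := (Fintype.card ι : ℤ) with hc
  have hc0 : 0 ≤ c := by positivity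
  have hd0 : (0:ℤ) ≤ (d:ℤ) := by positivity
  generalize (d:ℤ) = d at *
  generalize ∑ i, (∑ j, li L i j) ^ 2 = D1 at *
  generalize ∑ j, (∑ i, li L i j) ^ 2 = D2 at *
  have main : ∀ E F : ℤ, F ≤ E → (E - N) ^ 2 ≤ c ^ 2 * (2 * d ^ 2 * (E + F)) → N ^ 2 ≤ c * E →
      N ≤ 2 * c ∨ N ^ 2 ≤ 16 * c ^ 3 * d ^ 2 := by
    intro E F hFE h1 h2
    by_contra hcon
    push Not at hcon
    obtain ⟨h3, h4⟩ := hcon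
    have hNpos : 0 < N := by linarith
    have hcpos : 0 < c := by
      rcases hc0.eq_or_lt with q | q
      · rw [← q] at h2; nlinarith
      · exact q
    have hE : 2 * N < E := by
      by_contra hh
      push Not at hh
      have : c * E ≤ c * (2 * N) := by gcongr
      nlinarith
    have h5 : E ^ 2 ≤ 4 * (c ^ 2 * (2 * d ^ 2 * (E + F))) := by nlinarith
    have h6 : c ^ 2 * (2 * d ^ 2 * (E + F)) ≤ c ^ 2 * (2 * d ^ 2 * (E + E)) := by gcongr
    have h7 : E * E ≤ (16 * c ^ 2 * d ^ 2) * E := by nlinarith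
    have h8 : E ≤ 16 * c ^ 2 * d ^ 2 := le_of_mul_le_mul_right h7 (by linarith)
    have h9 : c * E ≤ c * (16 * c ^ 2 * d ^ 2) := by gcongr
    nlinarith
  rcases le_total D1 D2 with q | q
  · exact main D2 D1 q (by linarith) s2
  · exact main D1 D2 q (by linarith) s1

end core3

def LensOn (f g : ℝ → ℝ) (a b : ℝ) : Prop :=
  (∀ t, a < t → t < b → f t < g t) ∧ (∀ t, t < a → g t < f t) ∧ (∀ t, b < t → g t < f t)

structure LensSys {ι 𝓔 : Type*} (f : ι → ℝ → ℝ) (lo hi : 𝓔 → ℝ) (E : ι → Finset 𝓔) : Prop where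
  lt : ∀ i, ∀ e ∈ E i, lo e < hi e
  disj : ∀ i, ∀ e ∈ E i, ∀ e' ∈ E i, e ≠ e' → hi e ≤ lo e' ∨ hi e' ≤ lo e
  alt : ∀ i j, i ≠ j → ∀ t1 t2 t3 t4 : ℝ, t1 < t2 → t2 < t3 → t3 < t4 →
    f j t1 < f i t1 → f i t2 < f j t2 → f j t3 < f i t3 → f i t4 < f j t4 → False
  lens : ∀ i j, i ≠ j → ∀ e, e ∈ E i → e ∈ E j →
    LensOn (f i) (f j) (lo e) (hi e) ∨ LensOn (f j) (f i) (lo e) (hi e)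

namespace LensSys
variable {ι 𝓔 : Type*} {f : ι → ℝ → ℝ} {lo hi : 𝓔 → ℝ} {E : ι → Finset 𝓔}

noncomputable def mid (lo hi : 𝓔 → ℝ) (e : 𝓔) : ℝ := (lo e + hi e) / 2

lemma mid_mem (h : LensSys f lo hi E) {i : ι} {e : 𝓔} (he : e ∈ E i) :
    lo e < mid lo hi e ∧ mid lo hi e < hi e := by
  have := h.lt i e he
  unfold mid
  constructor <;> linarith

lemma unique (h : LensSys f lo hi E) {i j : ι} (hij : i ≠ j) {e e' : 𝓔} (h1 : e ∈ E i) (h2 : e ∈ E j)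
    (h3 : e' ∈ E i) (h4 : e' ∈ E j) : e = e' := by
  by_contra hne
  have key : ∀ e e' : 𝓔, e ∈ E i → e ∈ E j → e' ∈ E i → e' ∈ E j → hi e ≤ lo e' → False := by
    intro e e' h1 h2 h3 h4 hle
    have m1 := h.mid_mem h1
    have m2 := h.mid_mem h3
    have q1 : hi e < mid lo hi e' := by linarith
    have q2 : hi e < hi e' + 1 := by linarith
    rcases h.lens i j hij e h1 h2 with a | a <;> rcases h.lens i j hij e' h3 h4 with b | b
    · exact lt_asymm (a.2.2 _ q1) (b.1 _ m2.1 m2.2)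
    · exact lt_asymm (a.2.2 (hi e' + 1) q2) (b.2.2 _ (by linarith))
    · exact lt_asymm (a.2.2 (hi e' + 1) q2) (b.2.2 _ (by linarith))
    · exact lt_asymm (a.2.2 _ q1) (b.1 _ m2.1 m2.2)
  rcases h.disj i e h1 e' h3 hne with q | q
  · exact key e e' h1 h2 h3 h4 q
  · exact key e' e h3 h4 h1 h2 q

/-- `i` is immediately above `j` on a shared edge. -/
def Adj (f : ι → ℝ → ℝ) (lo hi : 𝓔 → ℝ) (E : ι → Finset 𝓔) (i j : ι) (e : 𝓔) : Prop :=
  e ∈ E i ∧ e ∈ E j ∧ f j (mid lo hi e) < f i (mid lo hi e) ∧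
    ∀ k, e ∈ E k → f j (mid lo hi e) < f k (mid lo hi e) → f k (mid lo hi e) < f i (mid lo hi e) →
      False

def Lam (f : ι → ℝ → ℝ) (lo hi : 𝓔 → ℝ) (E : ι → Finset 𝓔) (i j : ι) : Prop :=
  ∃ e, Adj f lo hi E i j e

open Classical in
noncomputable def xpos (f : ι → ℝ → ℝ) (lo hi : 𝓔 → ℝ) (E : ι → Finset 𝓔) (i j : ι) : ℝ :=
  if h : Lam f lo hi E i j then mid lo hi h.choose else 0

lemma Adj.ne {i j : ι} {e : 𝓔} (h : Adj f lo hi E i j e) : i ≠ j := by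
  rintro rfl
  exact lt_irrefl _ h.2.2.1

lemma xpos_eq (h : LensSys f lo hi E) {i j : ι} {e : 𝓔} (ha : Adj f lo hi E i j e) :
    xpos f lo hi E i j = mid lo hi e := by
  have hL : Lam f lo hi E i j := ⟨e, ha⟩
  rw [xpos, dif_pos hL]
  have := hL.choose_spec
  rw [h.unique ha.ne ha.1 ha.2.1 this.1 this.2.1]

lemma mid_inj (h : LensSys f lo hi E) {i : ι} {e e' : 𝓔} (h1 : e ∈ E i) (h2 : e' ∈ E i)
    (hm : mid lo hi e = mid lo hi e') : e = e' := by
  by_contra hne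
  have a := h.mid_mem h1
  have b := h.mid_mem h2
  rcases h.disj i e h1 e' h2 hne with q | q <;> linarith

lemma ne_at (h : LensSys f lo hi E) {i j : ι} (hij : i ≠ j) {e : 𝓔} (h1 : e ∈ E i) (h2 : e ∈ E j) :
    f i (mid lo hi e) ≠ f j (mid lo hi e) := by
  have m := h.mid_mem h1
  rcases h.lens i j hij e h1 h2 with a | a
  · exact (a.1 _ m.1 m.2).ne
  · exact (a.1 _ m.1 m.2).ne'

/-- off the shared edge, at the midpoint of another edge, the order is reversed -/
lemma off (h : LensSys f lo hi E) {i j k : ι} {e e' : 𝓔} (ha : Adj f lo hi E i j e)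
    (hk : k = i ∨ k = j) (h' : e' ∈ E k) (hne : mid lo hi e ≠ mid lo hi e') :
    f i (mid lo hi e') < f j (mid lo hi e') := by
  have m := h.mid_mem ha.1
  have m' := h.mid_mem h'
  have hek : e ∈ E k := by rcases hk with rfl | rfl; exacts [ha.1, ha.2.1]
  have hne' : e ≠ e' := fun hh => hne (by rw [hh])
  rcases h.lens i j ha.ne e ha.1 ha.2.1 with a | a
  · exact absurd (a.1 _ m.1 m.2) (not_lt.2 ha.2.2.1.le)
  · rcases h.disj k e hek e' h' hne' with q | q
    · exact a.2.2 _ (by linarith)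
    · exact a.2.1 _ (by linarith)

lemma no_rev (h : LensSys f lo hi E) {i i' j j' : ι} (h1 : Lam f lo hi E i j)
    (h2 : Lam f lo hi E i' j) (h3 : Lam f lo hi E i j') (h4 : Lam f lo hi E i' j')
    (q1 : xpos f lo hi E i j < xpos f lo hi E i' j)
    (q2 : xpos f lo hi E i j' < xpos f lo hi E i' j')
    (q3 : xpos f lo hi E i j < xpos f lo hi E i j')
    (q4 : xpos f lo hi E i' j < xpos f lo hi E i' j') : False := by
  have hii : i ≠ i' := by rintro rfl; exact lt_irrefl _ q1
  have hjj : j ≠ j' := by rintro rfl; exact lt_irrefl _ q3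
  obtain ⟨e1, h1⟩ := h1
  obtain ⟨e2, h2⟩ := h2
  obtain ⟨e3, h3⟩ := h3
  obtain ⟨e4, h4⟩ := h4
  rw [h.xpos_eq h1, h.xpos_eq h2] at q1
  rw [h.xpos_eq h3, h.xpos_eq h4] at q2
  rw [h.xpos_eq h1, h.xpos_eq h3] at q3
  rw [h.xpos_eq h2, h.xpos_eq h4] at q4
  -- at x1
  have a1 := h.off h2 (.inr rfl) h1.2.1 q1.ne'
  have a2 := h.off h3 (.inl rfl) h1.1 q3.ne'
  -- at x2
  have b1 := h.off h1 (.inr rfl) h2.2.1 q1.ne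
  have b2 := h.off h4 (.inl rfl) h2.1 q4.ne'
  -- at x3
  have c1 := h.off h1 (.inl rfl) h3.1 q3.ne
  have c2 := h.off h4 (.inr rfl) h3.2.1 q2.ne'
  -- at x4
  have d1 := h.off h3 (.inr rfl) h4.2.1 q2.ne
  have d2 := h.off h2 (.inl rfl) h4.1 q4.ne
  have A := h1.2.2.1
  have B := h2.2.2.1
  have C := h3.2.2.1
  have D := h4.2.2.1
  rcases lt_trichotomy (mid lo hi e2) (mid lo hi e3) with q | q | q
  · exact h.alt i i' hii _ _ _ _ q1 q q2 (a1.trans A) (b1.trans B) (c2.trans C) (d1.trans D)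
  · rw [q] at b1 B
    linarith
  · exact h.alt j' j hjj.symm _ _ _ _ q3 q q4 (A.trans a2) (C.trans c1) (B.trans b2) (D.trans d2)

lemma row_inj (h : LensSys f lo hi E) {i j j' : ι} (h1 : Lam f lo hi E i j)
    (h2 : Lam f lo hi E i j') (hx : xpos f lo hi E i j = xpos f lo hi E i j') : j = j' := by
  obtain ⟨e, h1⟩ := h1
  obtain ⟨e', h2⟩ := h2
  rw [h.xpos_eq h1, h.xpos_eq h2] at hx
  obtain rfl := h.mid_inj h1.1 h2.1 hx
  by_contra hne
  rcases lt_or_gt_of_ne (h.ne_at hne h1.2.1 h2.2.1) with q | q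
  · exact h1.2.2.2 _ h2.2.1 q h2.2.2.1
  · exact h2.2.2.2 _ h1.2.1 q h1.2.2.1

lemma col_inj (h : LensSys f lo hi E) {i i' j : ι} (h1 : Lam f lo hi E i j)
    (h2 : Lam f lo hi E i' j) (hx : xpos f lo hi E i j = xpos f lo hi E i' j) : i = i' := by
  obtain ⟨e, h1⟩ := h1
  obtain ⟨e', h2⟩ := h2
  rw [h.xpos_eq h1, h.xpos_eq h2] at hx
  obtain rfl := h.mid_inj h1.2.1 h2.2.1 hx
  by_contra hne
  rcases lt_or_gt_of_ne (h.ne_at hne h1.1 h2.1) with q | q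
  · exact h2.2.2.2 _ h1.1 h1.2.2.1 q
  · exact h1.2.2.2 _ h2.1 h2.2.2.1 q

theorem bound [Fintype ι] [DecidableEq ι] [DecidableEq 𝓔] (h : LensSys f lo hi E) (d : ℕ)
    (hd : (Fintype.card ι) ^ 2 ≤ 2 ^ d) :
    ∃ N : ℕ, ∑ i, (E i).card ≤ (univ.biUnion E).card + N ∧
      (N ≤ 2 * Fintype.card ι ∨ N ^ 2 ≤ 16 * (Fintype.card ι) ^ 3 * d ^ 2) := by
  classical
  let L := Lam f lo hi E
  let x := xpos f lo hi E
  let Λ : Finset (ι × ι) := univ.filter (fun p => L p.1 p.2)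
  let V : Finset ℝ := Λ.image (fun p => x p.1 p.2)
  let r : ι → ι → ℕ := fun i j => (V.filter (fun y => y < x i j)).card
  have hV : ∀ i j, L i j → x i j ∈ V := fun i j hl =>
    Finset.mem_image.2 ⟨(i, j), by simpa [Λ] using hl, rfl⟩
  have hmono : ∀ y z : ℝ, z ≤ y → (V.filter (fun v => v < z)).card ≤ (V.filter (fun v => v < y)).card := by
    intro y z hyz
    refine Finset.card_le_card fun v hv => ?_
    rw [mem_filter] at hv ⊢
    exact ⟨hv.1, hv.2.trans_le hyz⟩
  have hsm : ∀ i j i' j', L i j → L i' j' → x i j < x i' j' → r i j < r i' j' := by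
    intro i j i' j' h1 h2 hx
    refine Finset.card_lt_card ⟨fun v hv => ?_, fun hh => ?_⟩
    · rw [mem_filter] at hv ⊢
      exact ⟨hv.1, hv.2.trans hx⟩
    · have : x i j ∈ V.filter (fun y => y < x i j) := hh (by rw [mem_filter]; exact ⟨hV _ _ h1, hx⟩)
      rw [mem_filter] at this
      exact lt_irrefl _ this.2
  have hlt : ∀ i j i' j', r i j < r i' j' → x i j < x i' j' := by
    intro i j i' j' hr
    by_contra hh
    exact absurd (hmono _ _ (not_lt.1 hh)) (not_le.2 hr)
  have heq : ∀ i j i' j', L i j → L i' j' → r i j = r i' j' → x i j = x i' j' := by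
    intro i j i' j' h1 h2 hr
    rcases lt_trichotomy (x i j) (x i' j') with q | q | q
    · have := hsm _ _ _ _ h1 h2 q; omega
    · exact q
    · have := hsm _ _ _ _ h2 h1 q; omega
  have hR : RevRel L r d := by
    refine ⟨?_, ?_, ?_, ?_⟩
    · intro i j hl
      have h1 : r i j < V.card := by
        refine Finset.card_lt_card ⟨Finset.filter_subset _ _, fun hh => ?_⟩
        have := hh (hV i j hl)
        rw [mem_filter] at this
        exact lt_irrefl _ this.2
      have h2 : V.card ≤ (Fintype.card ι) ^ 2 := by
        refine Finset.card_image_le.trans ((Finset.card_filter_le _ _).trans ?_)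
        rw [card_univ, Fintype.card_prod, sq]
      omega
    · intro i j j' h1 h2 hr
      exact h.row_inj h1 h2 (heq _ _ _ _ h1 h2 hr)
    · intro i i' j h1 h2 hr
      exact h.col_inj h1 h2 (heq _ _ _ _ h1 h2 hr)
    · intro i i' j j' h1 h2 h3 h4 q1 q2 q3 q4
      exact h.no_rev h1 h2 h3 h4 (hlt _ _ _ _ q1) (hlt _ _ _ _ q2) (hlt _ _ _ _ q3) (hlt _ _ _ _ q4)
  refine ⟨Λ.card, ?_, ?_⟩
  · -- counting
    rw [← Finset.card_sigma]
    let S := (univ : Finset ι).sigma E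
    let low : (Σ _ : ι, 𝓔) → Prop := fun p => ∀ k, p.2 ∈ E k → ¬ f k (mid lo hi p.2) < f p.1 (mid lo hi p.2)
    have hsplit := Finset.card_filter_add_card_filter_not (s := S) low
    have hb1 : (S.filter low).card ≤ (univ.biUnion E).card := by
      refine Finset.card_le_card_of_injOn (fun p => p.2) ?_ ?_
      · rintro ⟨i, e⟩ hp
        simp only [S, coe_filter, mem_sigma, mem_univ, true_and, Set.mem_ofPred_eq] at hp
        simp only [coe_biUnion, Set.mem_iUnion]
        exact ⟨i, by simp, hp.1⟩
      · rintro ⟨i, e⟩ hp ⟨j, e'⟩ hq hpq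
        simp only [S, coe_filter, mem_sigma, mem_univ, true_and, Set.mem_ofPred_eq] at hp hq hpq
        subst hpq
        by_cases hij : i = j
        · subst hij; rfl
        · rcases lt_or_gt_of_ne (h.ne_at hij hp.1 hq.1) with q | q
          · exact absurd q (hq.2 _ hp.1)
          · exact absurd q (hp.2 _ hq.1)
    have hb2 : (S.filter (fun p => ¬ low p)).card ≤ Λ.card := by
      have hex : ∀ p : (Σ _ : ι, 𝓔), ∃ j : ι, p ∈ S.filter (fun p => ¬ low p) → Adj f lo hi E p.1 j p.2 := by
        rintro ⟨i, e⟩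
        by_cases hp : (⟨i, e⟩ : Σ _ : ι, 𝓔) ∈ S.filter (fun p => ¬ low p)
        · have hp' := hp
          simp only [S, low, mem_filter, mem_sigma, mem_univ, true_and, not_forall, not_not] at hp'
          obtain ⟨hi', k, hk, hk2⟩ := hp'
          let T := univ.filter (fun k => e ∈ E k ∧ f k (mid lo hi e) < f i (mid lo hi e))
          obtain ⟨j, hj, hmax⟩ := T.exists_max_image (fun k => f k (mid lo hi e))
            ⟨k, by simp only [T, mem_filter, mem_univ, true_and]; exact ⟨hk, hk2⟩⟩
          simp only [T, mem_filter, mem_univ, true_and] at hj hmax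
          refine ⟨j, fun _ => ⟨hi', hj.1, hj.2, fun k hk h1 h2 => ?_⟩⟩
          exact absurd (hmax k ⟨hk, h2⟩) (not_le.2 h1)
        · exact ⟨i, fun hh => absurd hh hp⟩
      choose g hg using hex
      refine Finset.card_le_card_of_injOn (fun p => (p.1, g p)) ?_ ?_
      · intro p hp
        simp only [Λ, coe_filter, mem_univ, true_and, Set.mem_ofPred_eq]
        exact ⟨_, hg p hp⟩
      · intro p hp q hq hpq
        have h1 := hg p hp
        have h2 := hg q hq
        obtain ⟨i, e⟩ := p
        obtain ⟨i', e'⟩ := q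
        simp only [Prod.mk.injEq] at hpq
        obtain ⟨rfl, hpq⟩ := hpq
        rw [← hpq] at h2
        have he : e = e' := h.unique h1.ne h1.1 h1.2.1 h2.1 h2.2.1
        rw [he]
    change S.card ≤ _
    omega
  · have hc := core_order hR (Λ.card : ℤ) (by
      simp only [Λ, Finset.card_filter, li]
      push_cast
      rw [← Finset.univ_product_univ, Finset.sum_product])
    rcases hc with hc | hc
    · left; exact_mod_cast hc
    · right; exact_mod_cast hc

end LensSys

lemma LensSys.comp {ι ι' 𝓔 : Type*} {f : ι → ℝ → ℝ} {lo hi : 𝓔 → ℝ} {E : ι → Finset 𝓔}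
    (h : LensSys f lo hi E) (g : ι' → ι) (hg : Function.Injective g) :
    LensSys (fun i => f (g i)) lo hi (fun i => E (g i)) where
  lt i e he := h.lt _ e he
  disj i e he e' he' hne := h.disj _ e he e' he' hne
  alt i j hij := h.alt _ _ (fun hh => hij (hg hh))
  lens i j hij := h.lens _ _ (fun hh => hij (hg hh))

theorem LensSys.cells {ι 𝓔 κ : Type*} [Fintype ι] [DecidableEq ι] [DecidableEq 𝓔] [DecidableEq κ]
    {f : ι → ℝ → ℝ} {lo hi : 𝓔 → ℝ} {E : ι → Finset 𝓔}
    (h : LensSys f lo hi E) (cell : ι → κ) (T s d M : ℕ)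
    (hT : ∀ e, ((univ.filter (fun i => e ∈ E i)).image cell).card ≤ T)
    (hs : ∀ k, (univ.filter (fun i => cell i = k)).card ≤ s)
    (hd : s ^ 2 ≤ 2 ^ d) (hM : ∀ i, M ≤ (E i).card) (hM4 : 4 ≤ M) (hsM : 64 * s * d ^ 2 ≤ M ^ 2) :
    ∑ i, (E i).card ≤ 2 * T * (univ.biUnion E).card := by
  classical
  have hcell : ∀ k, ∑ i ∈ univ.filter (fun i => cell i = k), (E i).card
      ≤ 2 * ((univ.filter (fun i => cell i = k)).biUnion E).card := by
    intro k
    set I := univ.filter (fun i => cell i = k) with hI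
    have hb := (h.comp (fun i : I => (i : ι)) Subtype.val_injective).bound d (by
      rw [Fintype.card_coe]
      exact (Nat.pow_le_pow_left (hs k) 2).trans hd)
    obtain ⟨N, h1, h2⟩ := hb
    rw [Fintype.card_coe] at h2
    rw [Finset.sum_coe_sort I (fun i => (E i).card)] at h1
    have e1 : (univ : Finset I).biUnion (fun i => E i) = I.biUnion E := by
      ext e; simp
    rw [e1] at h1
    have hS : M * I.card ≤ ∑ i ∈ I, (E i).card := by
      have := Finset.card_nsmul_le_sum I (fun i => (E i).card) M (fun i _ => hM i)
      rwa [smul_eq_mul, mul_comm] at this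
    have hc := hs k
    rw [← hI] at hc
    generalize (∑ i ∈ I, (E i).card) = S at *
    have h2N : 2 * N ≤ S := by
      rcases h2 with h2 | h2
      · nlinarith
      · have : (2 * N) ^ 2 ≤ (M * I.card) ^ 2 := by
          calc (2 * N) ^ 2 = 4 * N ^ 2 := by ring
            _ ≤ 4 * (16 * I.card ^ 3 * d ^ 2) := by gcongr
            _ = (64 * I.card * d ^ 2) * I.card ^ 2 := by ring
            _ ≤ (64 * s * d ^ 2) * I.card ^ 2 := by gcongr
            _ ≤ M ^ 2 * I.card ^ 2 := by gcongr
            _ = _ := by ring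
        have := (Nat.pow_le_pow_iff_left (two_ne_zero)).1 this
        omega
    omega
  have hsum : ∑ i, (E i).card = ∑ k ∈ univ.image cell, ∑ i ∈ univ.filter (fun i => cell i = k), (E i).card :=
    (Finset.sum_fiberwise_of_maps_to (fun i _ => Finset.mem_image_of_mem cell (mem_univ i)) _).symm
  rw [hsum]
  refine (Finset.sum_le_sum fun k _ => hcell k).trans ?_
  rw [← Finset.mul_sum, mul_assoc]
  refine Nat.mul_le_mul_left 2 ?_
  have hdc : ∑ k ∈ univ.image cell, ((univ.filter (fun i => cell i = k)).biUnion E).card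
      = ∑ e ∈ univ.biUnion E, ((univ.filter (fun i => e ∈ E i)).image cell).card := by
    have := Finset.sum_card_bipartiteAbove_eq_sum_card_bipartiteBelow
      (s := univ.image cell) (t := univ.biUnion E) (fun k e => ∃ i, cell i = k ∧ e ∈ E i)
    convert this using 2 with k hk e he
    · congr 1
      ext e
      simp only [mem_biUnion, mem_filter, mem_univ, true_and, bipartiteAbove]
      constructor
      · rintro ⟨i, h1, h2⟩; exact ⟨⟨i, h2⟩, i, h1, h2⟩
      · rintro ⟨_, i, h1, h2⟩; exact ⟨i, h1, h2⟩
    · congr 1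
      ext k
      simp only [mem_image, mem_filter, mem_univ, true_and, bipartiteBelow]
      constructor
      · rintro ⟨i, h1, h2⟩; exact ⟨⟨i, h2⟩, i, h2, h1⟩
      · rintro ⟨_, i, h1, h2⟩; exact ⟨i, h2, h1⟩
  rw [hdc]
  have := Finset.sum_le_card_nsmul (univ.biUnion E) (fun e => ((univ.filter (fun i => e ∈ E i)).image cell).card) T
    (fun e _ => hT e)
  rwa [smul_eq_mul, mul_comm] at this

section rank
variable {α : Type*} [LinearOrder α]

def rk (S : Finset α) (x : α) : ℕ := (S.filter (fun z => z < x)).card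

def blk (S : Finset α) (G : ℕ) (x : α) : ℕ := rk S x / G

lemma rk_mono (S : Finset α) {x y : α} (h : x ≤ y) : rk S x ≤ rk S y := by
  refine Finset.card_le_card fun v hv => ?_
  rw [mem_filter] at hv ⊢
  exact ⟨hv.1, hv.2.trans_le h⟩

lemma rk_lt (S : Finset α) {x y : α} (hx : x ∈ S) (h : x < y) : rk S x < rk S y := by
  refine Finset.card_lt_card ⟨fun v hv => ?_, fun hh => ?_⟩
  · rw [mem_filter] at hv ⊢
    exact ⟨hv.1, hv.2.trans h⟩
  · have : x ∈ S.filter (fun z => z < x) := hh (by rw [mem_filter]; exact ⟨hx, h⟩)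
    rw [mem_filter] at this
    exact lt_irrefl _ this.2

lemma rk_inj (S : Finset α) : Set.InjOn (rk S) (S : Set α) := by
  intro x hx y hy h
  rcases lt_trichotomy x y with q | q | q
  · have := rk_lt S hx q; omega
  · exact q
  · have := rk_lt S hy q; omega

lemma blk_mono (S : Finset α) (G : ℕ) {x y : α} (h : x ≤ y) : blk S G x ≤ blk S G y :=
  Nat.div_le_div_right (rk_mono S h)

lemma rk_le (S : Finset α) (x : α) : rk S x ≤ S.card := Finset.card_filter_le _ _

lemma blk_le (S : Finset α) (G : ℕ) (x : α) : blk S G x ≤ S.card / G :=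
  Nat.div_le_div_right (rk_le S x)

lemma blk_card (S : Finset α) (G : ℕ) (hG : 0 < G) (k : ℕ) :
    (S.filter (fun x => blk S G x = k)).card ≤ G := by
  have : (S.filter (fun x => blk S G x = k)).card ≤ (Finset.Ico (k * G) (k * G + G)).card := by
    refine Finset.card_le_card_of_injOn (rk S) ?_ ?_
    · intro x hx
      simp only [coe_filter, Set.mem_ofPred_eq] at hx
      unfold blk at hx
      simp only [coe_Ico, Set.mem_Ico]
      have h1 := Nat.div_mul_le_self (rk S x) G
      have h2 := Nat.lt_div_mul_add (a := rk S x) hG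
      rw [hx.2] at h1 h2
      exact ⟨h1, h2⟩
    · intro x hx y hy h
      simp only [coe_filter, Set.mem_ofPred_eq] at hx hy
      exact rk_inj S hx.1 hy.1 h
  simpa using this

/-- pairs in a common block -/
lemma blk_pairs (S : Finset α) (G : ℕ) (hG : 0 < G) :
    ((S ×ˢ S).filter (fun p => blk S G p.1 = blk S G p.2)).card ≤ S.card * G := by
  classical
  rw [Finset.card_eq_sum_card_fiberwise (f := fun p : α × α => p.1) (t := S)]
  · have := Finset.sum_le_card_nsmul S (fun x => (((S ×ˢ S).filter (fun p => blk S G p.1 = blk S G p.2)).filter (fun p => p.1 = x)).card) G ?_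
    · simpa using this
    · intro x hx
      refine le_trans ?_ (blk_card S G hG (blk S G x))
      refine Finset.card_le_card_of_injOn (fun p => p.2) ?_ ?_
      · rintro ⟨y, z⟩ hp
        simp only [coe_filter, mem_filter, mem_product, Set.mem_ofPred_eq] at hp ⊢
        obtain ⟨⟨⟨h1, h2⟩, h3⟩, rfl⟩ := hp
        exact ⟨h2, h3.symm⟩
      · rintro ⟨y, z⟩ hp ⟨y', z'⟩ hp' h
        simp only [coe_filter, mem_filter, mem_product, Set.mem_ofPred_eq] at hp hp' h
        rw [hp.2, hp'.2, h]
  · intro p hp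
    simp only [coe_filter, mem_product, Set.mem_ofPred_eq] at hp
    exact hp.1.1
end rank

section edges

/-- the next element of `S` after `t` -/
noncomputable def nxt (S : Finset ℝ) (t : ℝ) : ℝ :=
  if h : (S.filter (fun z => t < z)).Nonempty then (S.filter (fun z => t < z)).min' h else t

lemma nxt_spec {S : Finset ℝ} {t : ℝ} (h : (S.filter (fun z => t < z)).Nonempty) :
    nxt S t ∈ S ∧ t < nxt S t ∧ ∀ s ∈ S, t < s → nxt S t ≤ s := by
  rw [nxt, dif_pos h]
  have := Finset.min'_mem _ h
  rw [mem_filter] at this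
  refine ⟨this.1, this.2, fun s hs hts => Finset.min'_le _ _ ?_⟩
  rw [mem_filter]; exact ⟨hs, hts⟩

noncomputable def goodS (S : Finset ℝ) (φ₁ φ₂ : ℝ → ℕ) : Finset ℝ :=
  S.filter (fun t => (S.filter (fun z => t < z)).Nonempty ∧ φ₁ t = φ₁ (nxt S t) ∧
    φ₂ t = φ₂ (nxt S t))

lemma bad_card (S : Finset ℝ) (φ : ℝ → ℕ) (B : ℕ) (hφ : MonotoneOn φ S ∨ AntitoneOn φ S)
    (hB : ∀ t ∈ S, φ t ≤ B) :
    (S.filter (fun t => (S.filter (fun z => t < z)).Nonempty ∧ φ t ≠ φ (nxt S t))).card ≤ B + 1 := by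
  rw [← Finset.card_range (B + 1)]
  refine Finset.card_le_card_of_injOn φ ?_ ?_
  · intro t ht
    simp only [coe_filter, Set.mem_ofPred_eq] at ht
    have := hB t ht.1
    simp; omega
  · have key : ∀ t s : ℝ, t ∈ S → s ∈ S → (S.filter (fun z => t < z)).Nonempty → φ t ≠ φ (nxt S t) →
        t < s → φ t = φ s → False := by
      intro t s ht hs hne hφt hts heq
      obtain ⟨h1, h2, h3⟩ := nxt_spec hne
      have h4 := h3 s hs hts
      rcases hφ with hm | hm
      · have a := hm ht h1 h2.le
        have b := hm h1 hs h4
        omega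
      · have a := hm ht h1 h2.le
        have b := hm h1 hs h4
        omega
    intro t ht s hs heq
    simp only [coe_filter, Set.mem_ofPred_eq] at ht hs
    rcases lt_trichotomy t s with q | q | q
    · exact (key t s ht.1 hs.1 ht.2.1 ht.2.2 q heq).elim
    · exact q
    · exact (key s t hs.1 ht.1 hs.2.1 hs.2.2 q heq.symm).elim

lemma good_card (S : Finset ℝ) (φ₁ φ₂ : ℝ → ℕ) (B₁ B₂ : ℕ)
    (h₁ : MonotoneOn φ₁ S ∨ AntitoneOn φ₁ S) (h₂ : MonotoneOn φ₂ S ∨ AntitoneOn φ₂ S)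
    (hB₁ : ∀ t ∈ S, φ₁ t ≤ B₁) (hB₂ : ∀ t ∈ S, φ₂ t ≤ B₂) :
    S.card ≤ (goodS S φ₁ φ₂).card + B₁ + B₂ + 3 := by
  classical
  have b1 := bad_card S φ₁ B₁ h₁ hB₁
  have b2 := bad_card S φ₂ B₂ h₂ hB₂
  have hl : (S.filter (fun t => ¬ (S.filter (fun z => t < z)).Nonempty)).card ≤ 1 := by
    rw [Finset.card_le_one]
    intro a ha b hb
    simp only [mem_filter, not_nonempty_iff_eq_empty, filter_eq_empty_iff] at ha hb
    exact le_antisymm (not_lt.1 (hb.2 ha.1)) (not_lt.1 (ha.2 hb.1))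
  have hsub : S ⊆ goodS S φ₁ φ₂ ∪ (S.filter (fun t => (S.filter (fun z => t < z)).Nonempty ∧ φ₁ t ≠ φ₁ (nxt S t))
      ∪ (S.filter (fun t => (S.filter (fun z => t < z)).Nonempty ∧ φ₂ t ≠ φ₂ (nxt S t))
      ∪ S.filter (fun t => ¬ (S.filter (fun z => t < z)).Nonempty))) := by
    intro t ht
    simp only [goodS, mem_union, mem_filter, ht, true_and]
    tauto
  have := Finset.card_le_card hsub
  have u1 := Finset.card_union_le (goodS S φ₁ φ₂) (S.filter (fun t => (S.filter (fun z => t < z)).Nonempty ∧ φ₁ t ≠ φ₁ (nxt S t))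
      ∪ (S.filter (fun t => (S.filter (fun z => t < z)).Nonempty ∧ φ₂ t ≠ φ₂ (nxt S t))
      ∪ S.filter (fun t => ¬ (S.filter (fun z => t < z)).Nonempty)))
  have u2 := Finset.card_union_le (S.filter (fun t => (S.filter (fun z => t < z)).Nonempty ∧ φ₁ t ≠ φ₁ (nxt S t)))
      (S.filter (fun t => (S.filter (fun z => t < z)).Nonempty ∧ φ₂ t ≠ φ₂ (nxt S t))
      ∪ S.filter (fun t => ¬ (S.filter (fun z => t < z)).Nonempty))
  have u3 := Finset.card_union_le (S.filter (fun t => (S.filter (fun z => t < z)).Nonempty ∧ φ₂ t ≠ φ₂ (nxt S t)))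
      (S.filter (fun t => ¬ (S.filter (fun z => t < z)).Nonempty))
  omega

abbrev Edge := (ℝ × ℝ) × (ℝ × ℝ)

/-- edges of a curve -/
noncomputable def edgesOf (D₁ D₂ : Finset ℝ) (G : ℕ) (S : Finset ℝ) (pt : ℝ → ℝ × ℝ) : Finset Edge :=
  (goodS S (fun t => blk D₁ G (pt t).1) (fun t => blk D₂ G (pt t).2)).image
    (fun t => (pt t, pt (nxt S t)))

lemma mem_edgesOf {D₁ D₂ : Finset ℝ} {G : ℕ} {S : Finset ℝ} {pt : ℝ → ℝ × ℝ} {e : Edge}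
    (h : e ∈ edgesOf D₁ D₂ G S pt) : ∃ t ∈ S, nxt S t ∈ S ∧ t < nxt S t ∧
      (∀ s ∈ S, t < s → nxt S t ≤ s) ∧ e = (pt t, pt (nxt S t)) ∧
      blk D₁ G (pt t).1 = blk D₁ G (pt (nxt S t)).1 ∧ blk D₂ G (pt t).2 = blk D₂ G (pt (nxt S t)).2 := by
  rw [edgesOf, mem_image] at h
  obtain ⟨t, ht, rfl⟩ := h
  rw [goodS, mem_filter] at ht
  obtain ⟨h1, h2, h3⟩ := nxt_spec ht.2.1
  exact ⟨t, ht.1, h1, h2, h3, rfl, ht.2.2.1, ht.2.2.2⟩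

lemma edgesOf_card {D₁ D₂ : Finset ℝ} {G : ℕ} {S : Finset ℝ} {pt : ℝ → ℝ × ℝ} {ab : ℝ × ℝ → ℝ}
    (hab : ∀ t ∈ S, ab (pt t) = t)
    (h₁ : MonotoneOn (fun t => (pt t).1) S ∨ AntitoneOn (fun t => (pt t).1) S)
    (h₂ : MonotoneOn (fun t => (pt t).2) S ∨ AntitoneOn (fun t => (pt t).2) S) :
    S.card ≤ (edgesOf D₁ D₂ G S pt).card + D₁.card / G + D₂.card / G + 3 := by
  have hc : (edgesOf D₁ D₂ G S pt).card = (goodS S (fun t => blk D₁ G (pt t).1) (fun t => blk D₂ G (pt t).2)).card := by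
    refine Finset.card_image_of_injOn ?_
    intro t ht s hs hts
    simp only [goodS, coe_filter, Set.mem_ofPred_eq, Prod.mk.injEq] at ht hs hts
    rw [← hab t ht.1, ← hab s hs.1, hts.1]
  rw [hc]
  refine good_card S _ _ _ _ ?_ ?_ (fun t _ => blk_le _ _ _) (fun t _ => blk_le _ _ _)
  · rcases h₁ with h | h
    · left; intro a ha b hb hab; exact blk_mono _ _ (h ha hb hab)
    · right; intro a ha b hb hab; exact blk_mono _ _ (h ha hb hab)
  · rcases h₂ with h | h
    · left; intro a ha b hb hab; exact blk_mono _ _ (h ha hb hab)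
    · right; intro a ha b hb hab; exact blk_mono _ _ (h ha hb hab)

lemma union_card {ι : Type*} [Fintype ι] (D₁ D₂ : Finset ℝ) (G : ℕ) (hG : 0 < G) (S : ι → Finset ℝ)
    (pt : ι → ℝ → ℝ × ℝ) (hD : ∀ i, ∀ t ∈ S i, (pt i t).1 ∈ D₁ ∧ (pt i t).2 ∈ D₂) :
    (univ.biUnion (fun i => edgesOf D₁ D₂ G (S i) (pt i))).card ≤ D₁.card * G * (D₂.card * G) := by
  classical
  refine le_trans ?_ (Nat.mul_le_mul (blk_pairs D₁ G hG) (blk_pairs D₂ G hG))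
  rw [← Finset.card_product]
  refine Finset.card_le_card_of_injOn (fun e => ((e.1.1, e.2.1), (e.1.2, e.2.2))) ?_ ?_
  · intro e he
    simp only [coe_biUnion, Set.mem_iUnion] at he
    obtain ⟨i, -, he⟩ := he
    obtain ⟨t, h1, h2, h3, h4, rfl, h5, h6⟩ := mem_edgesOf he
    have a := hD i _ h1
    have b := hD i _ h2
    simp only [coe_product, Set.mem_prod, coe_filter, mem_product, Set.mem_ofPred_eq]
    exact ⟨⟨⟨a.1, b.1⟩, h5⟩, ⟨a.2, b.2⟩, h6⟩
  · rintro ⟨⟨a, b⟩, c, d⟩ _ ⟨⟨a', b'⟩, c', d'⟩ _ h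
    simp only [Prod.mk.injEq] at h ⊢
    tauto

/-- The sign of `f - g` is that of a (strictly) convex function. -/
def SC (f g : ℝ → ℝ) : Prop :=
  ∃ h : ℝ → ℝ, ConvexOn ℝ Set.univ h ∧ ∀ t, (0 < h t ↔ g t < f t) ∧ (h t < 0 ↔ f t < g t)

def SSC (f g : ℝ → ℝ) : Prop :=
  ∃ h : ℝ → ℝ, StrictConvexOn ℝ Set.univ h ∧ ∀ t, (0 < h t ↔ g t < f t) ∧ (h t < 0 ↔ f t < g t)

lemma convex_mid {h : ℝ → ℝ} (hc : ConvexOn ℝ Set.univ h) {a b c : ℝ} (hab : a < b) (hbc : b < c)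
    (ha : h a < 0) (hb : 0 < h b) (hcc : h c < 0) : False := by
  have := hc.le_max_of_mem_Icc (Set.mem_univ a) (Set.mem_univ c) ⟨hab.le, hbc.le⟩
  rcases le_max_iff.1 this with q | q <;> linarith

lemma sconvex_mid {h : ℝ → ℝ} (hc : StrictConvexOn ℝ Set.univ h) {a b c : ℝ} (hab : a < b) (hbc : b < c) :
    h b < max (h a) (h c) := by
  refine hc.lt_on_openSegment (Set.mem_univ a) (Set.mem_univ c) (by linarith) ?_
  rw [openSegment_eq_Ioo (hab.trans hbc)]
  exact ⟨hab, hbc⟩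

lemma sconvex_lens {h : ℝ → ℝ} (hc : StrictConvexOn ℝ Set.univ h) {a b : ℝ} (hab : a < b)
    (ha : h a = 0) (hb : h b = 0) :
    (∀ t, a < t → t < b → h t < 0) ∧ (∀ t, t < a → 0 < h t) ∧ (∀ t, b < t → 0 < h t) := by
  refine ⟨fun t h1 h2 => ?_, fun t h1 => ?_, fun t h1 => ?_⟩
  · have := sconvex_mid hc h1 h2
    rwa [ha, hb, max_self] at this
  · have := sconvex_mid hc h1 hab
    rw [ha, hb] at this
    simpa using this
  · have := sconvex_mid hc hab h1
    rw [ha, hb] at this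
    simpa using this

theorem mkLens {ι : Type*} (D₁ D₂ : Finset ℝ) (G : ℕ) (f : ι → ℝ → ℝ) (S : ι → Finset ℝ)
    (pt : ι → ℝ → ℝ × ℝ) (ab : ℝ × ℝ → ℝ) (or' : ℝ × ℝ → ℝ)
    (hab : ∀ i, ∀ t ∈ S i, ab (pt i t) = t) (hor : ∀ i, ∀ t ∈ S i, or' (pt i t) = f i t)
    (hc : ∀ i j, i ≠ j → SC (f i) (f j) ∨ SC (f j) (f i))
    (hs : ∀ i j, i ≠ j → ∀ e, e ∈ edgesOf D₁ D₂ G (S i) (pt i) → e ∈ edgesOf D₁ D₂ G (S j) (pt j) →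
      SSC (f i) (f j) ∨ SSC (f j) (f i)) :
    LensSys f (fun e : Edge => ab e.1) (fun e => ab e.2) (fun i => edgesOf D₁ D₂ G (S i) (pt i)) where
  lt i e he := by
    obtain ⟨t, h1, h2, h3, h4, rfl, -⟩ := mem_edgesOf he
    simpa [hab i _ h1, hab i _ h2] using h3
  disj i e he e' he' hne := by
    obtain ⟨t, h1, h2, h3, h4, rfl, -⟩ := mem_edgesOf he
    obtain ⟨s, k1, k2, k3, k4, rfl, -⟩ := mem_edgesOf he'
    simp only [hab i _ h1, hab i _ h2, hab i _ k1, hab i _ k2]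
    rcases lt_trichotomy t s with q | q | q
    · left; exact h4 s k1 q
    · subst q; exact absurd rfl hne
    · right; exact k4 t h1 q
  alt i j hij t1 t2 t3 t4 h12 h23 h34 a1 a2 a3 a4 := by
    rcases hc i j hij with ⟨h, hh, hs⟩ | ⟨h, hh, hs⟩
    · exact convex_mid hh h23 h34 ((hs t2).2.2 a2) ((hs t3).1.2 a3) ((hs t4).2.2 a4)
    · exact convex_mid hh h12 h23 ((hs t1).2.2 a1) ((hs t2).1.2 a2) ((hs t3).2.2 a3)
  lens i j hij e he he' := by
    have hss := hs i j hij e he he'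
    obtain ⟨t, h1, h2, h3, h4, rfl, -⟩ := mem_edgesOf he
    obtain ⟨s, k1, k2, k3, k4, hee, -⟩ := mem_edgesOf he'
    rw [Prod.mk.injEq] at hee
    have e1 : t = s := by rw [← hab i t h1, hee.1, hab j s k1]
    have e2 : nxt (S i) t = nxt (S j) s := by rw [← hab i _ h2, hee.2, hab j _ k2]
    have v1 : f i t = f j t := by rw [← hor i t h1, hee.1, hor j s k1, e1]
    have v2 : f i (nxt (S i) t) = f j (nxt (S i) t) := by rw [← hor i _ h2, hee.2, hor j _ k2, e2]
    simp only [hab i _ h1, hab i _ h2]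
    rcases hss with ⟨h, hh, hs⟩ | ⟨h, hh, hs⟩
    · have z1 : h t = 0 := le_antisymm (not_lt.1 fun q => ((hs t).1.1 q).ne' v1)
        (not_lt.1 fun q => ((hs t).2.1 q).ne v1)
      have z2 : h (nxt (S i) t) = 0 := le_antisymm (not_lt.1 fun q => ((hs _).1.1 q).ne' v2)
        (not_lt.1 fun q => ((hs _).2.1 q).ne v2)
      obtain ⟨l1, l2, l3⟩ := sconvex_lens hh h3 z1 z2
      exact .inl ⟨fun x p q => (hs x).2.1 (l1 x p q), fun x p => (hs x).1.1 (l2 x p),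
        fun x p => (hs x).1.1 (l3 x p)⟩
    · have z1 : h t = 0 := le_antisymm (not_lt.1 fun q => ((hs t).1.1 q).ne v1)
        (not_lt.1 fun q => ((hs t).2.1 q).ne' v1)
      have z2 : h (nxt (S i) t) = 0 := le_antisymm (not_lt.1 fun q => ((hs _).1.1 q).ne v2)
        (not_lt.1 fun q => ((hs _).2.1 q).ne' v2)
      obtain ⟨l1, l2, l3⟩ := sconvex_lens hh h3 z1 z2
      exact .inr ⟨fun x p q => (hs x).2.1 (l1 x p q), fun x p => (hs x).1.1 (l2 x p),
        fun x p => (hs x).1.1 (l3 x p)⟩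

end edges

lemma side_half (X : Finset ℝ) (a : ℝ) :
    ∃ σ : ℝ, (σ = 1 ∨ σ = -1) ∧ X.card ≤ 2 * (X.filter (fun x => 0 < σ * (x - a))).card + 1 := by
  classical
  have hsub : X ⊆ X.filter (fun x => 0 < (1:ℝ) * (x - a)) ∪ (X.filter (fun x => 0 < (-1:ℝ) * (x - a)) ∪ {a}) := by
    intro x hx
    simp only [mem_union, mem_filter, hx, true_and, mem_singleton]
    rcases lt_trichotomy x a with q | q | q
    · right; left; linarith
    · right; right; exact q
    · left; linarith
  have h1 := Finset.card_le_card hsub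
  have h2 := Finset.card_union_le (X.filter (fun x => 0 < (1:ℝ) * (x - a))) (X.filter (fun x => 0 < (-1:ℝ) * (x - a)) ∪ {a})
  have h3 := Finset.card_union_le (X.filter (fun x => 0 < (-1:ℝ) * (x - a))) {a}
  rw [card_singleton] at h3
  rcases le_total (X.filter (fun x => 0 < (1:ℝ) * (x - a))).card (X.filter (fun x => 0 < (-1:ℝ) * (x - a))).card with q | q
  · exact ⟨-1, .inr rfl, by omega⟩
  · exact ⟨1, .inl rfl, by omega⟩

lemma sq_affine_mono (S : Finset ℝ) (κ l c : ℝ)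
    (h : (∀ t ∈ S, 0 < κ * t + l) ∨ (∀ t ∈ S, κ * t + l < 0)) :
    MonotoneOn (fun t => (κ * t + l) ^ 2 + c) S ∨ AntitoneOn (fun t => (κ * t + l) ^ 2 + c) S := by
  rcases le_total 0 κ with hk | hk <;> rcases h with h | h
  · left; intro x hx y hy hxy
    have a := h x hx; have b := h y hy
    have : κ * x ≤ κ * y := by gcongr
    simp only; nlinarith
  · right; intro x hx y hy hxy
    have a := h x hx; have b := h y hy
    have : κ * x ≤ κ * y := by gcongr
    simp only; nlinarith
  · right; intro x hx y hy hxy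
    have a := h x hx; have b := h y hy
    have : κ * y ≤ κ * x := mul_le_mul_of_nonpos_left hxy hk
    simp only; nlinarith
  · left; intro x hx y hy hxy
    have a := h x hx; have b := h y hy
    have : κ * y ≤ κ * x := mul_le_mul_of_nonpos_left hxy hk
    simp only; nlinarith

lemma parab_order {κ₁ l₁ c₁ κ₂ l₂ c₂ t t' : ℝ} (htt : t < t')
    (e1 : (κ₁ * t + l₁) ^ 2 + c₁ = (κ₂ * t + l₂) ^ 2 + c₂)
    (e2 : (κ₁ * t' + l₁) ^ 2 + c₁ = (κ₂ * t' + l₂) ^ 2 + c₂)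
    (hκ : κ₂ ^ 2 < κ₁ ^ 2) (hs : 0 < (κ₁ * t + l₁) * (κ₁ * t' + l₁)) : c₂ < c₁ := by
  have hk : κ₁ ≠ 0 := by rintro rfl; nlinarith [sq_nonneg κ₂]
  -- difference formula
  have hd : ∀ w, (κ₁ * w + l₁) ^ 2 + c₁ - ((κ₂ * w + l₂) ^ 2 + c₂) = (κ₁ ^ 2 - κ₂ ^ 2) * ((w - t) * (w - t')) := by
    intro w
    have h3 : (t' - t) * ((κ₁ ^ 2 - κ₂ ^ 2) * (t + t') + 2 * (κ₁ * l₁ - κ₂ * l₂)) = 0 := by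
      linear_combination e2 - e1
    have h4 : (κ₁ ^ 2 - κ₂ ^ 2) * (t + t') + 2 * (κ₁ * l₁ - κ₂ * l₂) = 0 :=
      (mul_eq_zero.1 h3).resolve_left (by linarith)
    linear_combination e1 + (w - t) * h4
  have h0 := hd (-l₁ / κ₁)
  have hz : κ₁ * (-l₁ / κ₁) + l₁ = 0 := by field_simp; ring
  rw [hz] at h0
  have hprod : (κ₁ * t + l₁) * (κ₁ * t' + l₁) = κ₁ ^ 2 * ((-l₁ / κ₁ - t) * (-l₁ / κ₁ - t')) := by
    field_simp; ring
  have hp : 0 < (-l₁ / κ₁ - t) * (-l₁ / κ₁ - t') := by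
    rw [hprod] at hs
    exact pos_of_mul_pos_right hs (sq_nonneg _)
  have : 0 < (κ₁ ^ 2 - κ₂ ^ 2) * ((-l₁ / κ₁ - t) * (-l₁ / κ₁ - t')) := mul_pos (by linarith) hp
  nlinarith [sq_nonneg (κ₂ * (-l₁ / κ₁) + l₂)]

lemma parab_same {κ₁ l₁ c₁ κ₂ l₂ c₂ t t' : ℝ} (htt : t < t')
    (e1 : (κ₁ * t + l₁) ^ 2 + c₁ = (κ₂ * t + l₂) ^ 2 + c₂)
    (e2 : (κ₁ * t' + l₁) ^ 2 + c₁ = (κ₂ * t' + l₂) ^ 2 + c₂)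
    (hκ : κ₁ ^ 2 = κ₂ ^ 2) (h0 : κ₂ ≠ 0) :
    (κ₁ = κ₂ ∧ l₁ = l₂ ∧ c₁ = c₂) ∨ (κ₁ = -κ₂ ∧ l₁ = -l₂ ∧ c₁ = c₂) := by
  have h3 : (t' - t) * ((κ₁ ^ 2 - κ₂ ^ 2) * (t + t') + 2 * (κ₁ * l₁ - κ₂ * l₂)) = 0 := by
    linear_combination e2 - e1
  have h4 := (mul_eq_zero.1 h3).resolve_left (by linarith)
  have h5 : κ₁ * l₁ = κ₂ * l₂ := by rw [hκ] at h4; linarith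
  rcases sq_eq_sq_iff_eq_or_eq_neg.1 hκ with q | q
  · left
    subst q
    have := mul_left_cancel₀ h0 h5
    subst this
    exact ⟨rfl, rfl, by linarith⟩
  · right
    subst q
    have : -l₁ = l₂ := mul_left_cancel₀ h0 (by linarith)
    subst this
    refine ⟨rfl, by ring, ?_⟩
    linear_combination e1

lemma parab_SC (κ₁ l₁ c₁ κ₂ l₂ c₂ : ℝ) (h : κ₂ ^ 2 ≤ κ₁ ^ 2) :
    SC (fun w => (κ₁ * w + l₁) ^ 2 + c₁) (fun w => (κ₂ * w + l₂) ^ 2 + c₂) := by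
  refine ⟨fun w => (κ₁ * w + l₁) ^ 2 + c₁ - ((κ₂ * w + l₂) ^ 2 + c₂), ⟨convex_univ, ?_⟩, ?_⟩
  · intro x _ y _ a b ha hb hab
    simp only [smul_eq_mul]
    have hb' : b = 1 - a := by linarith
    subst hb'
    have : 0 ≤ a * (1 - a) * ((κ₁ ^ 2 - κ₂ ^ 2) * (x - y) ^ 2) :=
      mul_nonneg (mul_nonneg ha hb) (mul_nonneg (by linarith) (sq_nonneg _))
    nlinarith
  · intro t; constructor <;> constructor <;> intro h <;> simp only at * <;> linarith

lemma parab_SSC (κ₁ l₁ c₁ κ₂ l₂ c₂ : ℝ) (h : κ₂ ^ 2 < κ₁ ^ 2) :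
    SSC (fun w => (κ₁ * w + l₁) ^ 2 + c₁) (fun w => (κ₂ * w + l₂) ^ 2 + c₂) := by
  refine ⟨fun w => (κ₁ * w + l₁) ^ 2 + c₁ - ((κ₂ * w + l₂) ^ 2 + c₂), ⟨convex_univ, ?_⟩, ?_⟩
  · intro x _ y _ hxy a b ha hb hab
    simp only [smul_eq_mul]
    have hb' : b = 1 - a := by linarith
    subst hb'
    have hxy' : 0 < (x - y) ^ 2 := by
      have : x - y ≠ 0 := sub_ne_zero.2 hxy
      positivity
    have : 0 < a * (1 - a) * ((κ₁ ^ 2 - κ₂ ^ 2) * (x - y) ^ 2) :=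
      mul_pos (mul_pos ha hb) (mul_pos (by linarith) hxy')
    nlinarith
  · intro t; constructor <;> constructor <;> intro h <;> simp only at * <;> linarith

theorem rowsB (X : Finset ℝ) (P : Finset (ℝ × ℝ)) (D : Finset ℝ)
    (hD : ∀ x ∈ X, ∀ p ∈ P, (x - p.1) ^ 2 + p.2 ^ 2 ∈ D) (hX : X.Nonempty)
    (hn : 5 * D.card ≤ P.card) (G G₁ G₂ d M : ℕ) (hG : 0 < G) (hG₁ : 0 < G₁) (hG₂ : 0 < G₂)
    (hM : 4 * (M + 2 * (D.card / G) + 3) + 3 ≤ X.card) (hM4 : 4 ≤ M)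
    (hd : (G₁ * G₂) ^ 2 ≤ 2 ^ d) (hMd : 64 * (G₁ * G₂) * d ^ 2 ≤ M ^ 2) :
    M * (P.image (fun p => p.2 ^ 2)).card * P.card
      ≤ 8 * ((P.image (fun p => p.2 ^ 2)).card / G₁ + P.card / G₂ + 1) * (D.card * G * (D.card * G)) := by
  classical
  set Y := P.image (fun p : ℝ × ℝ => p.2 ^ 2) with hY
  set Q := P.image (fun p : ℝ × ℝ => (p.1, p.2 ^ 2)) with hQ
  -- size of Q
  have hQ1 : P.card ≤ 2 * Q.card := by
    have := Finset.card_le_mul_card_image (f := fun p : ℝ × ℝ => (p.1, p.2 ^ 2)) P 2 (by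
      intro q hq
      have hsub : P.filter (fun p => (p.1, p.2 ^ 2) = q) ⊆ {(q.1, Real.sqrt q.2), (q.1, -Real.sqrt q.2)} := by
        intro p hp
        rw [mem_filter] at hp
        obtain ⟨hp, rfl⟩ := hp
        simp only [mem_insert, mem_singleton, Real.sqrt_sq_eq_abs]
        rcases abs_choice p.2 with q | q <;> rw [q]
        · left; rfl
        · right; simp
      exact (Finset.card_le_card hsub).trans Finset.card_le_two)
    exact this
  have hQ2 : Q.card ≤ P.card := Finset.card_image_le
  have hDQ : ∀ x ∈ X, ∀ q ∈ Q, (x - q.1) ^ 2 + q.2 ∈ D := by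
    intro x hx q hq
    obtain ⟨p, hp, rfl⟩ := mem_image.1 hq
    exact hD x hx p hp
  -- representatives
  have hrep : ∀ y : ℝ, ∃ a : ℝ, y ∈ Y → (a, y) ∈ Q := by
    intro y
    by_cases hy : y ∈ Y
    · obtain ⟨p, hp, rfl⟩ := mem_image.1 hy
      exact ⟨p.1, fun _ => mem_image.2 ⟨p, hp, rfl⟩⟩
    · exact ⟨0, fun h => absurd h hy⟩
  choose a ha using hrep
  choose σ hσ hσc using fun y : ℝ => side_half X (a y)
  choose τ hτ hτc using fun (y : ℝ) (b : ℝ) => side_half (X.filter (fun x => 0 < σ y * (x - a y))) b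
  -- indices
  set I : Finset (ℝ × (ℝ × ℝ)) := (Y ×ˢ Q).filter (fun i => i.2.1 ≠ a i.1) with hI
  have hcol : ∀ b : ℝ, (Q.filter (fun q => q.1 = b)).card ≤ D.card := by
    intro b
    obtain ⟨x, hx⟩ := hX
    refine Finset.card_le_card_of_injOn (fun q => (x - q.1) ^ 2 + q.2) ?_ ?_
    · intro q hq
      simp only [coe_filter, Set.mem_ofPred_eq] at hq
      exact hDQ x hx q hq.1
    · intro q hq q' hq' h
      simp only [coe_filter, Set.mem_ofPred_eq] at hq hq' h
      rw [hq.2, hq'.2] at h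
      refine Prod.ext (hq.2.trans hq'.2.symm) (by linarith)
  have hIcard : Y.card * P.card ≤ 4 * I.card := by
    have h1 : Y.card * (Q.card - D.card) ≤ I.card := by
      rw [Finset.card_eq_sum_card_fiberwise (s := I) (f := fun i => i.1) (t := Y)]
      · have := Finset.card_nsmul_le_sum Y (fun y => (I.filter (fun i => i.1 = y)).card) (Q.card - D.card) ?_
        · simpa using this
        · intro y hy
          have h2 : (Q.filter (fun q => ¬ q.1 = a y)).card ≤ (I.filter (fun i => i.1 = y)).card := by
            refine Finset.card_le_card_of_injOn (fun q => (y, q)) ?_ ?_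
            · intro q hq
              simp only [coe_filter, Set.mem_ofPred_eq] at hq
              simp only [hI, coe_filter, mem_filter, mem_product, Set.mem_ofPred_eq]
              exact ⟨⟨⟨hy, hq.1⟩, hq.2⟩, trivial⟩
            · intro q _ q' _ h
              exact (Prod.mk.inj h).2
          have h3 := Finset.card_filter_add_card_filter_not (s := Q) (fun q => q.1 = a y)
          have h4 := hcol (a y)
          omega
      · intro i hi
        simp only [hI, coe_filter, mem_product, Set.mem_ofPred_eq] at hi
        exact hi.1.1
    have h2 : P.card ≤ 4 * (Q.card - D.card) := by omega
    calc Y.card * P.card ≤ Y.card * (4 * (Q.card - D.card)) := by gcongr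
      _ = 4 * (Y.card * (Q.card - D.card)) := by ring
      _ ≤ _ := by gcongr
  -- curves
  let δ : I → ℝ := fun i => i.1.2.1 - a i.1.1
  let κ : I → ℝ := fun i => 1 / (2 * δ i)
  let l : I → ℝ := fun i => (δ i ^ 2 - i.1.1 + i.1.2.2) / (2 * δ i)
  let f : I → ℝ → ℝ := fun i w => (κ i * w + l i) ^ 2 + i.1.1
  let pt : I → ℝ → ℝ × ℝ := fun i w => (f i w, (κ i * w + (l i - δ i)) ^ 2 + i.1.2.2)
  let Sx : I → Finset ℝ := fun i => (X.filter (fun x => 0 < σ i.1.1 * (x - a i.1.1))).filter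
    (fun x => 0 < τ i.1.1 i.1.2.1 * (x - i.1.2.1))
  let wm : I → ℝ → ℝ := fun i x => (x - a i.1.1) ^ 2 + i.1.1 - ((x - i.1.2.1) ^ 2 + i.1.2.2)
  let S : I → Finset ℝ := fun i => (Sx i).image (wm i)
  have hδ : ∀ i : I, δ i ≠ 0 := by
    intro i
    have := i.2
    simp only [hI, mem_filter] at this
    exact sub_ne_zero.2 this.2
  have hκ : ∀ i : I, κ i ≠ 0 := fun i => one_div_ne_zero (mul_ne_zero two_ne_zero (hδ i))
  have hIY : ∀ i : I, i.1.1 ∈ Y := fun i => (mem_product.1 (mem_filter.1 i.2).1).1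
  have hIQ : ∀ i : I, i.1.2 ∈ Q := fun i => (mem_product.1 (mem_filter.1 i.2).1).2
  have hz : ∀ (i : I) (x : ℝ), κ i * wm i x + l i = x - a i.1.1 := by
    intro i x
    have := hδ i
    simp only [κ, l, wm]
    field_simp
    simp only [δ]
    ring
  have hz2 : ∀ (i : I) (x : ℝ), κ i * wm i x + (l i - δ i) = x - i.1.2.1 := by
    intro i x
    rw [← add_sub_assoc, hz]; simp only [δ]; ring
  have hwinj : ∀ i : I, Function.Injective (wm i) := by
    intro i x x' h
    have h1 := hz i x
    have h2 := hz i x'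
    rw [h] at h1
    linarith
  have hScard : ∀ i : I, X.card ≤ 4 * (S i).card + 3 := by
    intro i
    have h1 : (S i).card = (Sx i).card := Finset.card_image_of_injective _ (hwinj i)
    have h2 := hσc i.1.1
    have h3 := hτc i.1.1 i.1.2.1
    rw [h1]
    change X.card ≤ 4 * (((X.filter (fun x => 0 < σ i.1.1 * (x - a i.1.1))).filter
      (fun x => 0 < τ i.1.1 i.1.2.1 * (x - i.1.2.1))).card) + 3
    omega
  have hSmem : ∀ (i : I) (t : ℝ), t ∈ S i → ∃ x ∈ X, 0 < σ i.1.1 * (x - a i.1.1) ∧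
      0 < τ i.1.1 i.1.2.1 * (x - i.1.2.1) ∧ t = wm i x := by
    intro i t ht
    obtain ⟨x, hx, rfl⟩ := mem_image.1 ht
    simp only [Sx, mem_filter] at hx
    exact ⟨x, hx.1.1, hx.1.2, hx.2, rfl⟩
  have hptD : ∀ i : I, ∀ t ∈ S i, (pt i t).1 ∈ D ∧ (pt i t).2 ∈ D := by
    intro i t ht
    obtain ⟨x, hx, -, -, rfl⟩ := hSmem i t ht
    simp only [pt, f, hz, hz2]
    exact ⟨hDQ x hx _ (ha _ (hIY i)), hDQ x hx _ (hIQ i)⟩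
  let ab : ℝ × ℝ → ℝ := fun p => p.1 - p.2
  have hab0 : ∀ (i : I) (t : ℝ), (pt i t).2 = f i t - t := by
    intro i t
    have h1 : 2 * δ i * (κ i * t + l i) = t + δ i ^ 2 - i.1.1 + i.1.2.2 := by
      have := hδ i
      simp only [κ, l]
      field_simp
      ring
    simp only [pt, f]
    linear_combination (-1) * h1
  have hab : ∀ i : I, ∀ t ∈ S i, ab (pt i t) = t := by
    intro i t ht
    change (pt i t).1 - (pt i t).2 = t
    rw [hab0]
    change f i t - (f i t - t) = t
    ring
  -- signs
  have hsgn1 : ∀ i : I, ∀ t ∈ S i, 0 < σ i.1.1 * (κ i * t + l i) := by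
    intro i t ht
    obtain ⟨x, hx, h1, h2, rfl⟩ := hSmem i t ht
    rwa [hz]
  have hsgn2 : ∀ i : I, ∀ t ∈ S i, 0 < τ i.1.1 i.1.2.1 * (κ i * t + (l i - δ i)) := by
    intro i t ht
    obtain ⟨x, hx, h1, h2, rfl⟩ := hSmem i t ht
    rwa [hz2]
  have hpm : ∀ (s : ℝ) (T : Finset ℝ) (g : ℝ → ℝ), (s = 1 ∨ s = -1) → (∀ t ∈ T, 0 < s * g t) →
      (∀ t ∈ T, 0 < g t) ∨ (∀ t ∈ T, g t < 0) := by
    rintro s T g (rfl | rfl) h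
    · left; intro t ht; linarith [h t ht]
    · right; intro t ht; linarith [h t ht]
  have hprod : ∀ (s u v : ℝ), (s = 1 ∨ s = -1) → 0 < s * u → 0 < s * v → 0 < u * v := by
    rintro s u v (rfl | rfl) h1 h2 <;> nlinarith
  have hmono1 : ∀ i : I, MonotoneOn (fun t => (pt i t).1) (S i) ∨ AntitoneOn (fun t => (pt i t).1) (S i) := by
    intro i
    exact sq_affine_mono (S i) (κ i) (l i) i.1.1 (hpm _ _ _ (hσ _) (hsgn1 i))
  have hmono2 : ∀ i : I, MonotoneOn (fun t => (pt i t).2) (S i) ∨ AntitoneOn (fun t => (pt i t).2) (S i) := by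
    intro i
    exact sq_affine_mono (S i) (κ i) (l i - δ i) i.1.2.2 (hpm _ _ _ (hτ _ _) (hsgn2 i))
  let E : I → Finset Edge := fun i => edgesOf D D G (S i) (pt i)
  -- shared edge facts
  have hshare : ∀ i j : I, ∀ e, e ∈ E i → e ∈ E j → ∃ t t' : ℝ, t < t' ∧ t ∈ S i ∧ t' ∈ S i ∧ t ∈ S j ∧
      t' ∈ S j ∧ pt i t = pt j t ∧ pt i t' = pt j t' := by
    intro i j e hi hj
    obtain ⟨t, h1, h2, h3, -, rfl, -⟩ := mem_edgesOf hi
    obtain ⟨s, k1, k2, k3, -, hee, -⟩ := mem_edgesOf hj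
    rw [Prod.mk.injEq] at hee
    have e1 : t = s := by rw [← hab i t h1, hee.1, hab j s k1]
    have e2 : nxt (S i) t = nxt (S j) s := by rw [← hab i _ h2, hee.2, hab j _ k2]
    refine ⟨t, nxt (S i) t, h3, h1, h2, e1 ▸ k1, e2 ▸ k2, ?_, ?_⟩
    · rw [hee.1, e1]
    · rw [hee.2, e2]
  have hneκ : ∀ i j : I, i ≠ j → ∀ e, e ∈ E i → e ∈ E j → κ i ^ 2 ≠ κ j ^ 2 := by
    intro i j hij e hi hj hk
    obtain ⟨t, t', htt, m1, m2, m3, m4, e1, e2⟩ := hshare i j e hi hj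
    have q1 := congrArg Prod.fst e1
    have q2 := congrArg Prod.fst e2
    rcases parab_same htt q1 q2 hk (hκ j) with ⟨c1, c2, c3⟩ | ⟨c1, c2, c3⟩
    · apply hij
      have hδe : δ i = δ j := by
        have h1 : δ i = 1 / (2 * κ i) := by have := hδ i; simp only [κ]; field_simp
        have h2 : δ j = 1 / (2 * κ j) := by have := hδ j; simp only [κ]; field_simp
        rw [h1, h2, c1]
      have hβ : i.1.2.2 = j.1.2.2 := by
        have h1 : δ i ^ 2 - i.1.1 + i.1.2.2 = l i * (2 * δ i) := by
          have := hδ i; simp only [l]; field_simp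
        have h2 : δ j ^ 2 - j.1.1 + j.1.2.2 = l j * (2 * δ j) := by
          have := hδ j; simp only [l]; field_simp
        rw [c2, hδe, c3] at h1
        linarith
      have haa : i.1.2.1 = j.1.2.1 := by
        simp only [δ] at hδe
        rw [c3] at hδe
        linarith
      exact Subtype.ext (Prod.ext c3 (Prod.ext haa hβ))
    · have s1 := hsgn1 i t m1
      have s2 := hsgn1 j t m3
      rw [c1, c2, c3] at s1
      nlinarith
  have hL : LensSys f (fun e : Edge => ab e.1) (fun e => ab e.2) E := by
    refine mkLens D D G f S pt ab Prod.fst hab (fun i t ht => rfl) ?_ ?_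
    · intro i j hij
      rcases le_total (κ j ^ 2) (κ i ^ 2) with q | q
      · left; exact parab_SC _ _ _ _ _ _ q
      · right; exact parab_SC _ _ _ _ _ _ q
    · intro i j hij e hi hj
      rcases lt_or_gt_of_ne (hneκ i j hij e hi hj) with q | q
      · right; exact parab_SSC _ _ _ _ _ _ q
      · left; exact parab_SSC _ _ _ _ _ _ q
  -- order on shared edge
  have hord : ∀ i j : I, ∀ e, e ∈ E i → e ∈ E j → κ j ^ 2 < κ i ^ 2 →
      j.1.1 < i.1.1 ∧ j.1.2.2 < i.1.2.2 := by
    intro i j e hi hj hk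
    obtain ⟨t, t', htt, m1, m2, m3, m4, e1, e2⟩ := hshare i j e hi hj
    have q1 := congrArg Prod.fst e1
    have q2 := congrArg Prod.fst e2
    have r1 := congrArg Prod.snd e1
    have r2 := congrArg Prod.snd e2
    exact ⟨parab_order htt q1 q2 hk (hprod _ _ _ (hσ _) (hsgn1 i t m1) (hsgn1 i t' m2)),
      parab_order htt r1 r2 hk (hprod _ _ _ (hτ _ _) (hsgn2 i t m1) (hsgn2 i t' m2))⟩
  -- cells
  let lx : ℝ × ℝ → ℝ ×ₗ ℝ := fun q => toLex (q.2, q.1)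
  have hlx : Function.Injective lx := by
    intro q q' h
    have := toLex.injective h
    rw [Prod.mk.injEq] at this
    exact Prod.ext this.2 this.1
  let Q' : Finset (ℝ ×ₗ ℝ) := Q.image lx
  have hQ'c : Q'.card = Q.card := Finset.card_image_of_injective _ hlx
  let cell : I → ℕ × ℕ := fun i => (blk Y G₁ i.1.1, blk Q' G₂ (lx i.1.2))
  have hMi : ∀ i, M ≤ (E i).card := by
    intro i
    have h1 := edgesOf_card (D₁ := D) (D₂ := D) (G := G) (hab i) (hmono1 i) (hmono2 i)
    have h2 := hScard i
    change M ≤ (edgesOf D D G (S i) (pt i)).card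
    omega
  have hfin := hL.cells cell (Y.card / G₁ + P.card / G₂ + 1) (G₁ * G₂) d M ?_ ?_ hd hMi hM4 hMd
  · have hU := union_card D D G hG S pt hptD
    have hsum : M * I.card ≤ ∑ i, (E i).card := by
      have := Finset.card_nsmul_le_sum univ (fun i => (E i).card) M (fun i _ => hMi i)
      rw [smul_eq_mul, card_univ, Fintype.card_coe, mul_comm] at this
      exact this
    calc M * Y.card * P.card = M * (Y.card * P.card) := by ring
      _ ≤ M * (4 * I.card) := by gcongr
      _ = 4 * (M * I.card) := by ring
      _ ≤ 4 * (2 * (Y.card / G₁ + P.card / G₂ + 1) * (D.card * G * (D.card * G))) := by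
        refine Nat.mul_le_mul_left 4 ?_
        exact hsum.trans (hfin.trans (Nat.mul_le_mul_left _ hU))
      _ = _ := by ring
  · intro e
    rw [← Finset.card_range (Y.card / G₁ + P.card / G₂ + 1)]
    refine Finset.card_le_card_of_injOn (fun c => c.1 + c.2) ?_ ?_
    · intro c hc
      obtain ⟨i, -, rfl⟩ := mem_image.1 (mem_coe.1 hc)
      have h1 := blk_le Y G₁ i.1.1
      have h2 := blk_le Q' G₂ (lx i.1.2)
      have h3 : Q'.card / G₂ ≤ P.card / G₂ := Nat.div_le_div_right (hQ'c.trans_le hQ2)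
      simp only [cell, coe_range, Set.mem_Iio]
      omega
    · intro c hc c' hc' h
      obtain ⟨i, hi, rfl⟩ := mem_image.1 (mem_coe.1 hc)
      obtain ⟨j, hj, rfl⟩ := mem_image.1 (mem_coe.1 hc')
      rw [mem_filter] at hi hj
      have key : ∀ i j : I, e ∈ E i → e ∈ E j → κ j ^ 2 < κ i ^ 2 →
          (cell j).1 ≤ (cell i).1 ∧ (cell j).2 ≤ (cell i).2 := by
        intro i j hi hj hk
        obtain ⟨h1, h2⟩ := hord i j e hi hj hk
        refine ⟨blk_mono _ _ h1.le, blk_mono _ _ ?_⟩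
        exact (Prod.Lex.toLex_lt_toLex.2 (.inl h2)).le
      by_cases hij : i = j
      · rw [hij]
      · simp only at h
        rcases lt_or_gt_of_ne (hneκ i j hij e hi.2 hj.2) with q | q
        · have := key j i hj.2 hi.2 q
          exact Prod.ext (by omega) (by omega)
        · have := key i j hi.2 hj.2 q
          exact Prod.ext (by omega) (by omega)
  · intro k
    have h1 : (univ.filter (fun i => cell i = k)).card ≤
        ((Y.filter (fun y => blk Y G₁ y = k.1)) ×ˢ (Q'.filter (fun q => blk Q' G₂ q = k.2))).card := by
      refine Finset.card_le_card_of_injOn (fun i => (i.1.1, lx i.1.2)) ?_ ?_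
      · intro i hi
        simp only [coe_filter, mem_univ, true_and, Set.mem_ofPred_eq] at hi
        simp only [coe_product, coe_filter, Set.mem_prod, Set.mem_ofPred_eq]
        refine ⟨⟨hIY i, ?_⟩, mem_image_of_mem lx (hIQ i), ?_⟩
        · rw [← hi]
        · rw [← hi]
      · intro i _ j _ h
        rw [Prod.mk.injEq] at h
        exact Subtype.ext (Prod.ext h.1 (hlx h.2))
    refine h1.trans ?_
    rw [card_product]
    exact Nat.mul_le_mul (blk_card _ _ hG₁ _) (blk_card _ _ hG₂ _)

/-- hyperbola branch -/
noncomputable def hyp (γ : ℝ × ℝ × ℝ) (t : ℝ) : ℝ := γ.2.1 + Real.sqrt ((t - γ.1) ^ 2 + γ.2.2)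

lemma sqrt_sconvex (α τ : ℝ) (hτ : 0 < τ) {x y a b : ℝ} (hxy : x ≠ y) (ha : 0 < a) (hb : 0 < b)
    (hab : a + b = 1) :
    Real.sqrt ((a * x + b * y - α) ^ 2 + τ) <
      a * Real.sqrt ((x - α) ^ 2 + τ) + b * Real.sqrt ((y - α) ^ 2 + τ) := by
  have hx : 0 < (x - α) ^ 2 + τ := by positivity
  have hy : 0 < (y - α) ^ 2 + τ := by positivity
  have h1 := Real.sq_sqrt hx.le
  have h2 := Real.sq_sqrt hy.le
  have p1 := Real.sqrt_pos.2 hx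
  have p2 := Real.sqrt_pos.2 hy
  set u := Real.sqrt ((x - α) ^ 2 + τ)
  set v := Real.sqrt ((y - α) ^ 2 + τ)
  rw [Real.sqrt_lt' (by positivity)]
  have huv : (x - α) * (y - α) + τ < u * v := by
    have hsq : ((x - α) * (y - α) + τ) ^ 2 < (u * v) ^ 2 := by
      rw [mul_pow, h1, h2]
      have : 0 < τ * (x - y) ^ 2 := mul_pos hτ (by have := sub_ne_zero.2 hxy; positivity)
      nlinarith
    exact lt_of_pow_lt_pow_left₀ 2 (by positivity) hsq
  have hb' : b = 1 - a := by linarith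
  subst hb'
  have hp : 0 < a * (1 - a) * (u * v - ((x - α) * (y - α) + τ)) :=
    mul_pos (mul_pos ha hb) (by linarith)
  have hid : (a * u + (1 - a) * v) ^ 2 - ((a * x + (1 - a) * y - α) ^ 2 + τ)
      = 2 * (a * (1 - a) * (u * v - ((x - α) * (y - α) + τ))) := by
    linear_combination a ^ 2 * h1 + (1 - a) ^ 2 * h2
  linarith

lemma hyp_sign (γ η : ℝ × ℝ × ℝ) (h1 : 0 < γ.2.2) (h2 : 0 < η.2.2) (hle : η.2.1 ≤ γ.2.1) :
    ∃ A B : ℝ, ∀ t,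
      (0 < 2 * (γ.2.1 - η.2.1) * Real.sqrt ((t - γ.1) ^ 2 + γ.2.2) + (A * t + B) ↔ hyp η t < hyp γ t) ∧
      (2 * (γ.2.1 - η.2.1) * Real.sqrt ((t - γ.1) ^ 2 + γ.2.2) + (A * t + B) < 0 ↔ hyp γ t < hyp η t) := by
  refine ⟨2 * (η.1 - γ.1), γ.1 ^ 2 - η.1 ^ 2 + γ.2.2 - η.2.2 + (γ.2.1 - η.2.1) ^ 2, fun t => ?_⟩
  have hx : 0 < (t - γ.1) ^ 2 + γ.2.2 := by positivity
  have hy : 0 < (t - η.1) ^ 2 + η.2.2 := by positivity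
  have s1 := Real.sq_sqrt hx.le
  have s2 := Real.sq_sqrt hy.le
  have p1 := Real.sqrt_pos.2 hx
  have p2 := Real.sqrt_pos.2 hy
  unfold hyp
  set u := Real.sqrt ((t - γ.1) ^ 2 + γ.2.2)
  set v := Real.sqrt ((t - η.1) ^ 2 + η.2.2)
  have hid : 2 * (γ.2.1 - η.2.1) * u + (2 * (η.1 - γ.1) * t + (γ.1 ^ 2 - η.1 ^ 2 + γ.2.2 - η.2.2 + (γ.2.1 - η.2.1) ^ 2))
      = (γ.2.1 + u - (η.2.1 + v)) * (γ.2.1 - η.2.1 + u + v) := by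
    linear_combination s2 - s1
  have hpos : 0 < γ.2.1 - η.2.1 + u + v := by linarith
  rw [hid]
  constructor
  · rw [mul_pos_iff_of_pos_right hpos, sub_pos]
  · rw [← neg_pos, ← neg_mul, mul_pos_iff_of_pos_right hpos, neg_pos, sub_neg]

lemma hyp_SSC (γ η : ℝ × ℝ × ℝ) (h1 : 0 < γ.2.2) (h2 : 0 < η.2.2) (hlt : η.2.1 < γ.2.1) :
    SSC (hyp γ) (hyp η) := by
  obtain ⟨A, B, h⟩ := hyp_sign γ η h1 h2 hlt.le
  refine ⟨_, ⟨convex_univ, ?_⟩, h⟩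
  intro x _ y _ hxy a b ha hb hab
  have := mul_lt_mul_of_pos_left (sqrt_sconvex γ.1 γ.2.2 h1 hxy ha hb hab)
    (show 0 < 2 * (γ.2.1 - η.2.1) by linarith)
  simp only [smul_eq_mul]
  have hb' : b = 1 - a := by linarith
  subst hb'
  linarith

lemma hyp_SC (γ η : ℝ × ℝ × ℝ) (h1 : 0 < γ.2.2) (h2 : 0 < η.2.2) (hle : η.2.1 ≤ γ.2.1) :
    SC (hyp γ) (hyp η) := by
  rcases hle.eq_or_lt with q | q
  · obtain ⟨A, B, h⟩ := hyp_sign γ η h1 h2 hle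
    refine ⟨_, ⟨convex_univ, ?_⟩, h⟩
    intro x _ y _ a b ha hb hab
    simp only [smul_eq_mul, q, sub_self, mul_zero, zero_mul, zero_add]
    have hb' : b = 1 - a := by linarith
    subst hb'
    linarith
  · obtain ⟨h, h3, h4⟩ := hyp_SSC γ η h1 h2 q
    exact ⟨h, h3.convexOn, h4⟩

lemma hyp_order {a a' τ b b' σ x x' w w' : ℝ} (hx : x < x') (hax : a ≤ x) (hbx : b ≤ x)
    (hw : a' < w) (hw' : a' < w')
    (e1 : (w - a') ^ 2 = (x - a) ^ 2 + τ) (e2 : (w' - a') ^ 2 = (x' - a) ^ 2 + τ)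
    (e3 : (w - b') ^ 2 = (x - b) ^ 2 + σ) (e4 : (w' - b') ^ 2 = (x' - b) ^ 2 + σ) :
    w < w' ∧ (a < b → a' < b' ∧ (w' - w ≤ x' - x → σ ≤ τ) ∧ (x' - x ≤ w' - w → τ ≤ σ)) ∧
      (a = b → a' = b' ∧ τ = σ) := by
  have hww : w < w' := by
    by_contra hh
    push Not at hh
    nlinarith
  have hp : (w' - w) * (b' - a') = (x' - x) * (b - a) := by linear_combination (e2 - e1 - e4 + e3) / 2
  have hs : (w' - w) * (w + w' - a' - b') = (x' - x) * (x + x' - a - b) := by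
    linear_combination (e2 - e1 + e4 - e3) / 2
  have ht : τ - σ = (b' - a') * (w + w' - a' - b') - (b - a) * (x + x' - a - b) := by
    linear_combination (-e1 - e2 + e3 + e4) / 2
  have hdw : 0 < w' - w := by linarith
  have hdx : 0 < x' - x := by linarith
  have hk : (w' - w) ^ 2 * (τ - σ) = (b - a) * (x + x' - a - b) * ((x' - x) ^ 2 - (w' - w) ^ 2) := by
    rw [ht]
    linear_combination (w' - w) * (w + w' - a' - b') * hp + (x' - x) * (b - a) * hs
  have hq : 0 < x + x' - a - b := by linarith
  refine ⟨hww, fun hab => ⟨?_, fun hle => ?_, fun hle => ?_⟩, fun hab => ?_⟩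
  · have : 0 < (w' - w) * (b' - a') := by rw [hp]; exact mul_pos hdx (by linarith)
    have := pos_of_mul_pos_right this hdw.le
    linarith
  · have h1 : 0 ≤ (w' - w) ^ 2 * (τ - σ) := by
      rw [hk]
      exact mul_nonneg (mul_nonneg (by linarith) hq.le) (by nlinarith)
    have := nonneg_of_mul_nonneg_right h1 (by positivity)
    linarith
  · have h1 : 0 ≤ (w' - w) ^ 2 * (σ - τ) := by
      have : (w' - w) ^ 2 * (σ - τ) = (b - a) * (x + x' - a - b) * ((w' - w) ^ 2 - (x' - x) ^ 2) := by
        linear_combination -hk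
      rw [this]
      exact mul_nonneg (mul_nonneg (by linarith) hq.le) (by nlinarith)
    have := nonneg_of_mul_nonneg_right h1 (by positivity)
    linarith
  · subst hab
    have h1 : b' - a' = 0 := by
      have : (w' - w) * (b' - a') = 0 := by rw [hp]; ring
      exact (mul_eq_zero.1 this).resolve_left hdw.ne'
    refine ⟨by linarith, ?_⟩
    rw [h1] at ht
    linarith

noncomputable def hypS (X₁ X₂ : Finset ℝ) (γ : ℝ × ℝ × ℝ) : Finset ℝ :=
  X₁.filter (fun x => γ.1 ≤ x ∧ hyp γ x ∈ X₂)

theorem hyperE (X₁ X₂ : Finset ℝ) (Γ : Finset (ℝ × ℝ × ℝ)) (A₁ A₂ 𝒯 : Finset ℝ)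
    (hΓ : ∀ γ ∈ Γ, 0 < γ.2.2 ∧ γ.1 ∈ A₁ ∧ γ.2.1 ∈ A₂ ∧ γ.2.2 ∈ 𝒯)
    (M₀ M G Ga Gt d : ℕ) (hM₀ : ∀ γ ∈ Γ, M₀ ≤ (hypS X₁ X₂ γ).card)
    (hG : 0 < G) (hGa : 0 < Ga) (hGt : 0 < Gt)
    (hMG : 2 * (X₁.card / G + X₂.card / G + 3) ≤ M₀) (hMM : 2 * M ≤ M₀) (hM4 : 4 ≤ M)
    (hd : (Ga * Ga * Gt) ^ 2 ≤ 2 ^ d) (hMd : 64 * (Ga * Ga * Gt) * d ^ 2 ≤ M ^ 2) :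
    ∑ γ ∈ Γ, (hypS X₁ X₂ γ).card ≤
      4 * (A₁.card / Ga + A₂.card / Ga + 𝒯.card / Gt + 1) * (X₁.card * G * (X₂.card * G)) := by
  classical
  let f : Γ → ℝ → ℝ := fun γ => hyp γ.1
  let pt : Γ → ℝ → ℝ × ℝ := fun γ t => (t, hyp γ.1 t)
  let S : Γ → Finset ℝ := fun γ => hypS X₁ X₂ γ.1
  have hSm : ∀ (γ : Γ) (t : ℝ), t ∈ S γ → t ∈ X₁ ∧ γ.1.1 ≤ t ∧ hyp γ.1 t ∈ X₂ := by
    intro γ t ht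
    simpa only [S, hypS, mem_filter] using ht
  have hτ : ∀ γ : Γ, 0 < γ.1.2.2 := fun γ => (hΓ γ.1 γ.2).1
  let E : Γ → Finset Edge := fun γ => edgesOf X₁ X₂ G (S γ) (pt γ)
  have heq : ∀ (γ : Γ) (t : ℝ), γ.1.2.1 < hyp γ.1 t ∧ (hyp γ.1 t - γ.1.2.1) ^ 2 = (t - γ.1.1) ^ 2 + γ.1.2.2 := by
    intro γ t
    have h0 : 0 < (t - γ.1.1) ^ 2 + γ.1.2.2 := by have := hτ γ; positivity
    unfold hyp
    constructor
    · have := Real.sqrt_pos.2 h0; linarith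
    · rw [add_sub_cancel_left, Real.sq_sqrt h0.le]
  have hmono2 : ∀ γ : Γ, MonotoneOn (fun t => (pt γ t).2) (S γ) := by
    intro γ t ht s hs hts
    have h1 := (hSm γ t ht).2.1
    simp only [pt, hyp]
    gcongr
  -- shared edge
  have hshare : ∀ i j : Γ, ∀ e, e ∈ E i → e ∈ E j →
      (i.1.1 < j.1.1 → i.1.2.1 < j.1.2.1 ∧ (e.2.2 - e.1.2 ≤ e.2.1 - e.1.1 → j.1.2.2 ≤ i.1.2.2) ∧
        (e.2.1 - e.1.1 ≤ e.2.2 - e.1.2 → i.1.2.2 ≤ j.1.2.2)) ∧ (i.1.1 = j.1.1 → i = j) := by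
    intro i j e hi hj
    obtain ⟨t, h1, h2, h3, -, rfl, -⟩ := mem_edgesOf hi
    obtain ⟨s, k1, k2, k3, -, hee, -⟩ := mem_edgesOf hj
    simp only [pt, Prod.mk.injEq] at hee
    obtain ⟨⟨rfl, q1⟩, q2, q3⟩ := hee
    rw [← q2] at q3
    have := hyp_order h3 (hSm i t h1).2.1 (hSm j t k1).2.1 (heq i t).1 (heq i (nxt (S i) t)).1
      (heq i t).2 (heq i (nxt (S i) t)).2 (q1 ▸ (heq j t).2) (q3 ▸ (heq j (nxt (S i) t)).2)
    refine ⟨fun hab => this.2.1 hab, fun hab => ?_⟩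
    obtain ⟨c1, c2⟩ := this.2.2 hab
    exact Subtype.ext (Prod.ext hab (Prod.ext c1 c2))
  have hL : LensSys f (fun e : Edge => e.1.1) (fun e => e.2.1) E := by
    refine mkLens X₁ X₂ G f S pt Prod.fst Prod.snd (fun i t ht => rfl) (fun i t ht => rfl) ?_ ?_
    · intro i j hij
      rcases le_total j.1.2.1 i.1.2.1 with q | q
      · left; exact hyp_SC _ _ (hτ i) (hτ j) q
      · right; exact hyp_SC _ _ (hτ j) (hτ i) q
    · intro i j hij e hi hj
      rcases lt_trichotomy i.1.1 j.1.1 with q | q | q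
      · right; exact hyp_SSC _ _ (hτ j) (hτ i) ((hshare i j e hi hj).1 q).1
      · exact absurd ((hshare i j e hi hj).2 q) hij
      · left; exact hyp_SSC _ _ (hτ i) (hτ j) ((hshare j i e hj hi).1 q).1
  have hMi : ∀ i, (S i).card ≤ 2 * (E i).card ∧ M ≤ (E i).card := by
    intro i
    have h1 := edgesOf_card (D₁ := X₁) (D₂ := X₂) (G := G) (S := S i) (pt := pt i) (ab := Prod.fst)
      (fun t ht => rfl) (.inl fun a _ b _ hab => hab) (.inl (hmono2 i))
    have h2 : M₀ ≤ (S i).card := hM₀ i.1 i.2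
    change (S i).card ≤ 2 * (edgesOf X₁ X₂ G (S i) (pt i)).card ∧ M ≤ (edgesOf X₁ X₂ G (S i) (pt i)).card
    omega
  let cell : Γ → ℕ × ℕ × ℕ := fun i => (blk A₁ Ga i.1.1, blk A₂ Ga i.1.2.1, blk 𝒯 Gt i.1.2.2)
  have hfin := hL.cells cell (A₁.card / Ga + A₂.card / Ga + 𝒯.card / Gt + 1) (Ga * Ga * Gt) d M ?_ ?_ hd
    (fun i => (hMi i).2) hM4 hMd
  · have hU := union_card X₁ X₂ G hG S pt (fun i t ht => ⟨(hSm i t ht).1, (hSm i t ht).2.2⟩)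
    calc ∑ γ ∈ Γ, (hypS X₁ X₂ γ).card = ∑ i : Γ, (S i).card := by
          rw [← Finset.sum_coe_sort Γ (fun γ => (hypS X₁ X₂ γ).card)]
      _ ≤ ∑ i : Γ, 2 * (E i).card := Finset.sum_le_sum fun i _ => (hMi i).1
      _ = 2 * ∑ i : Γ, (E i).card := by rw [Finset.mul_sum]
      _ ≤ 2 * (2 * (A₁.card / Ga + A₂.card / Ga + 𝒯.card / Gt + 1) * (X₁.card * G * (X₂.card * G))) :=
          Nat.mul_le_mul_left 2 (hfin.trans (Nat.mul_le_mul_left _ hU))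
      _ = _ := by ring
  · intro e
    rw [← Finset.card_range (A₁.card / Ga + A₂.card / Ga + 𝒯.card / Gt + 1)]
    have hle : ∀ i, (cell i).1 ≤ A₁.card / Ga ∧ (cell i).2.1 ≤ A₂.card / Ga ∧ (cell i).2.2 ≤ 𝒯.card / Gt :=
      fun i => ⟨blk_le _ _ _, blk_le _ _ _, blk_le _ _ _⟩
    have hcm : ∀ i j : Γ, e ∈ E i → e ∈ E j → i.1.1 < j.1.1 → (cell i).1 ≤ (cell j).1 ∧
        (cell i).2.1 ≤ (cell j).2.1 ∧ (e.2.2 - e.1.2 ≤ e.2.1 - e.1.1 → (cell j).2.2 ≤ (cell i).2.2) ∧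
        (e.2.1 - e.1.1 ≤ e.2.2 - e.1.2 → (cell i).2.2 ≤ (cell j).2.2) := by
      intro i j hi hj hab
      obtain ⟨h1, h2, h3⟩ := (hshare i j e hi hj).1 hab
      exact ⟨blk_mono _ _ hab.le, blk_mono _ _ h1.le, fun q => blk_mono _ _ (h2 q),
        fun q => blk_mono _ _ (h3 q)⟩
    rcases le_total (e.2.2 - e.1.2) (e.2.1 - e.1.1) with hc | hc
    · refine Finset.card_le_card_of_injOn (fun c => c.1 + c.2.1 + (𝒯.card / Gt - c.2.2)) ?_ ?_
      · intro c hc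
        obtain ⟨i, -, rfl⟩ := mem_image.1 (mem_coe.1 hc)
        have := hle i
        simp only [coe_range, Set.mem_Iio]
        omega
      · intro c hc' c' hc'' h
        obtain ⟨i, hi, rfl⟩ := mem_image.1 (mem_coe.1 hc')
        obtain ⟨j, hj, rfl⟩ := mem_image.1 (mem_coe.1 hc'')
        rw [mem_filter] at hi hj
        simp only at h
        have l1 := hle i
        have l2 := hle j
        rcases lt_trichotomy i.1.1 j.1.1 with q | q | q
        · obtain ⟨g1, g2, g3, g4⟩ := hcm i j hi.2 hj.2 q
          have g3 := g3 hc
          exact Prod.ext (by omega) (Prod.ext (by omega) (by omega))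
        · rw [(hshare i j e hi.2 hj.2).2 q]
        · obtain ⟨g1, g2, g3, g4⟩ := hcm j i hj.2 hi.2 q
          have g3 := g3 hc
          exact Prod.ext (by omega) (Prod.ext (by omega) (by omega))
    · refine Finset.card_le_card_of_injOn (fun c => c.1 + c.2.1 + c.2.2) ?_ ?_
      · intro c hc
        obtain ⟨i, -, rfl⟩ := mem_image.1 (mem_coe.1 hc)
        have := hle i
        simp only [coe_range, Set.mem_Iio]
        omega
      · intro c hc' c' hc'' h
        obtain ⟨i, hi, rfl⟩ := mem_image.1 (mem_coe.1 hc')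
        obtain ⟨j, hj, rfl⟩ := mem_image.1 (mem_coe.1 hc'')
        rw [mem_filter] at hi hj
        simp only at h
        rcases lt_trichotomy i.1.1 j.1.1 with q | q | q
        · obtain ⟨g1, g2, g3, g4⟩ := hcm i j hi.2 hj.2 q
          have g3 := g4 hc
          exact Prod.ext (by omega) (Prod.ext (by omega) (by omega))
        · rw [(hshare i j e hi.2 hj.2).2 q]
        · obtain ⟨g1, g2, g3, g4⟩ := hcm j i hj.2 hi.2 q
          have g3 := g4 hc
          exact Prod.ext (by omega) (Prod.ext (by omega) (by omega))
  · intro k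
    have h1 : (univ.filter (fun i => cell i = k)).card ≤
        ((A₁.filter (fun y => blk A₁ Ga y = k.1)) ×ˢ ((A₂.filter (fun y => blk A₂ Ga y = k.2.1)) ×ˢ
          (𝒯.filter (fun y => blk 𝒯 Gt y = k.2.2)))).card := by
      refine Finset.card_le_card_of_injOn (fun i => i.1) ?_ ?_
      · intro i hi
        simp only [coe_filter, mem_univ, true_and, Set.mem_ofPred_eq] at hi
        simp only [coe_product, coe_filter, Set.mem_prod, Set.mem_ofPred_eq]
        have := hΓ i.1 i.2
        refine ⟨⟨this.2.1, ?_⟩, ⟨this.2.2.1, ?_⟩, this.2.2.2, ?_⟩ <;> rw [← hi]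
      · intro i _ j _ h
        exact Subtype.ext h
    refine h1.trans ?_
    rw [card_product, card_product, mul_assoc]
    exact Nat.mul_le_mul (blk_card _ _ hGa _) (Nat.mul_le_mul (blk_card _ _ hGa _) (blk_card _ _ hGt _))

/-- squared distance from (x,0) to p -/
noncomputable def kap (z : ℝ × (ℝ × ℝ)) : ℝ := (z.1 - z.2.1) ^ 2 + z.2.2 ^ 2

/-- quadruples (x,p),(w,q) at equal distance -/
noncomputable def quads (X : Finset ℝ) (P : Finset (ℝ × ℝ)) :
    Finset ((ℝ × (ℝ × ℝ)) × (ℝ × (ℝ × ℝ))) :=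
  ((X ×ˢ P) ×ˢ (X ×ˢ P)).filter (fun z => kap z.1 = kap z.2)

lemma quads_lower (X : Finset ℝ) (P : Finset (ℝ × ℝ)) (D : Finset ℝ)
    (hD : ∀ x ∈ X, ∀ p ∈ P, (x - p.1) ^ 2 + p.2 ^ 2 ∈ D)
    (hn : 5 * D.card ≤ P.card) (hP : 0 < P.card) :
    5 * (X.card ^ 2 * P.card) ≤ (quads X P).card := by
  have h := card_sq_le_pairs (X ×ˢ P) D kap (by
    rintro ⟨x, p⟩ hz
    rw [mem_product] at hz
    exact hD x hz.1 p hz.2)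
  change (X ×ˢ P).card ^ 2 ≤ D.card * (quads X P).card at h
  rw [card_product] at h
  have h2 : P.card * (5 * (X.card ^ 2 * P.card)) ≤ P.card * (quads X P).card := by
    calc P.card * (5 * (X.card ^ 2 * P.card)) = 5 * (X.card * P.card) ^ 2 := by ring
      _ ≤ 5 * (D.card * (quads X P).card) := by gcongr
      _ = (5 * D.card) * (quads X P).card := by ring
      _ ≤ _ := by gcongr
  exact Nat.le_of_mul_le_mul_left h2 hP

lemma quads_eq (X : Finset ℝ) (P : Finset (ℝ × ℝ)) :
    ((quads X P).filter (fun z => z.1.2.2 ^ 2 = z.2.2.2 ^ 2)).card ≤ 4 * (X.card ^ 2 * P.card) := by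
  classical
  have hsub : (quads X P).filter (fun z => z.1.2.2 ^ 2 = z.2.2.2 ^ 2) ⊆
      ((X ×ˢ P) ×ˢ (X ×ˢ (({1, -1} : Finset ℝ) ×ˢ ({1, -1} : Finset ℝ)))).image
        (fun z => (z.1, (z.2.1, (z.2.1 - z.2.2.1 * (z.1.1 - z.1.2.1), z.2.2.2 * z.1.2.2)))) := by
    rintro ⟨⟨x, a, b⟩, ⟨w, c, e⟩⟩ hz
    simp only [quads, mem_filter, mem_product] at hz
    simp only [kap] at hz
    obtain ⟨⟨⟨⟨hx, hp⟩, hw, hq⟩, hk⟩, he⟩ := hz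
    have hk' : (w - c) ^ 2 = (x - a) ^ 2 := by linarith
    obtain ⟨s, hs, hs'⟩ : ∃ s ∈ ({1, -1} : Finset ℝ), w - c = s * (x - a) := by
      rcases sq_eq_sq_iff_eq_or_eq_neg.1 hk' with h | h
      · exact ⟨1, by simp, by linarith⟩
      · exact ⟨-1, by simp, by linarith⟩
    obtain ⟨t, ht, ht'⟩ : ∃ t ∈ ({1, -1} : Finset ℝ), e = t * b := by
      rcases sq_eq_sq_iff_eq_or_eq_neg.1 he with h | h
      · exact ⟨1, by simp, by linarith⟩
      · exact ⟨-1, by simp, by linarith⟩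
    rw [mem_image]
    refine ⟨((x, a, b), (w, s, t)), ?_, ?_⟩
    · simp only [mem_product]
      exact ⟨⟨hx, hp⟩, hw, hs, ht⟩
    · simp only [Prod.mk.injEq, true_and]
      exact ⟨by linarith, ht'.symm⟩
  refine (card_le_card hsub).trans (card_image_le.trans ?_)
  simp only [card_product]
  have : ({1, -1} : Finset ℝ).card ≤ 2 := card_le_two
  calc X.card * P.card * (X.card * (({1, -1} : Finset ℝ).card * ({1, -1} : Finset ℝ).card))
      ≤ X.card * P.card * (X.card * (2 * 2)) := by gcongr
    _ = _ := by ring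

lemma quads_lt (X : Finset ℝ) (P : Finset (ℝ × ℝ)) (D : Finset ℝ)
    (hD : ∀ x ∈ X, ∀ p ∈ P, (x - p.1) ^ 2 + p.2 ^ 2 ∈ D)
    (hn : 5 * D.card ≤ P.card) (hP : 0 < P.card) :
    X.card ^ 2 * P.card ≤ 2 * ((quads X P).filter (fun z => z.2.2.2 ^ 2 < z.1.2.2 ^ 2)).card := by
  classical
  have h1 := quads_lower X P D hD hn hP
  have h2 := quads_eq X P
  have hsw : ((quads X P).filter (fun z => z.1.2.2 ^ 2 < z.2.2.2 ^ 2)).card ≤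
      ((quads X P).filter (fun z => z.2.2.2 ^ 2 < z.1.2.2 ^ 2)).card := by
    apply card_le_card_of_injOn Prod.swap
    · rintro ⟨z, w⟩ hz
      simp only [quads, coe_filter, mem_filter, mem_product, Set.mem_ofPred_eq, Prod.swap] at hz ⊢
      exact ⟨⟨⟨hz.1.1.2, hz.1.1.1⟩, hz.1.2.symm⟩, hz.2⟩
    · exact Prod.swap_injective.injOn
  have hun : quads X P = (quads X P).filter (fun z => z.1.2.2 ^ 2 = z.2.2.2 ^ 2) ∪
      ((quads X P).filter (fun z => z.2.2.2 ^ 2 < z.1.2.2 ^ 2) ∪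
      (quads X P).filter (fun z => z.1.2.2 ^ 2 < z.2.2.2 ^ 2)) := by
    ext z
    simp only [mem_union, mem_filter]
    have := lt_trichotomy (z.1.2.2 ^ 2) (z.2.2.2 ^ 2)
    tauto
  have h3 := card_union_le ((quads X P).filter (fun z => z.1.2.2 ^ 2 = z.2.2.2 ^ 2))
    ((quads X P).filter (fun z => z.2.2.2 ^ 2 < z.1.2.2 ^ 2) ∪
      (quads X P).filter (fun z => z.1.2.2 ^ 2 < z.2.2.2 ^ 2))
  rw [← hun] at h3
  have h4 := card_union_le ((quads X P).filter (fun z => z.2.2.2 ^ 2 < z.1.2.2 ^ 2))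
      ((quads X P).filter (fun z => z.1.2.2 ^ 2 < z.2.2.2 ^ 2))
  omega

lemma quads_sign (X : Finset ℝ) (P : Finset (ℝ × ℝ)) :
    ∃ s t : ℝ, (s = 1 ∨ s = -1) ∧ (t = 1 ∨ t = -1) ∧
      ((quads X P).filter (fun z => z.2.2.2 ^ 2 < z.1.2.2 ^ 2)).card ≤
      4 * (((quads X P).filter (fun z => z.2.2.2 ^ 2 < z.1.2.2 ^ 2)).filter
        (fun z => 0 ≤ s * (z.1.1 - z.1.2.1) ∧ 0 ≤ t * (z.2.1 - z.2.2.1))).card := by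
  classical
  set S := (quads X P).filter (fun z => z.2.2.2 ^ 2 < z.1.2.2 ^ 2) with hS
  have hne : (({1, -1} : Finset ℝ) ×ˢ ({1, -1} : Finset ℝ)).Nonempty := ⟨(1, 1), by simp⟩
  by_contra hcon
  push Not at hcon
  have hsub : S ⊆ (({1, -1} : Finset ℝ) ×ˢ ({1, -1} : Finset ℝ)).biUnion (fun st => S.filter
      (fun z => 0 ≤ st.1 * (z.1.1 - z.1.2.1) ∧ 0 ≤ st.2 * (z.2.1 - z.2.2.1))) := by
    intro z hz
    have key : ∀ u : ℝ, ∃ s ∈ ({1, -1} : Finset ℝ), 0 ≤ s * u := by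
      intro u
      rcases le_total 0 u with h | h
      · exact ⟨1, by simp, by linarith⟩
      · exact ⟨-1, by simp, by linarith⟩
    obtain ⟨s, hs, hs'⟩ := key (z.1.1 - z.1.2.1)
    obtain ⟨t, ht, ht'⟩ := key (z.2.1 - z.2.2.1)
    rw [mem_biUnion]
    exact ⟨(s, t), mem_product.2 ⟨hs, ht⟩, mem_filter.2 ⟨hz, hs', ht'⟩⟩
  have h1 := (card_le_card hsub).trans card_biUnion_le
  have h2 : ∑ st ∈ (({1, -1} : Finset ℝ) ×ˢ ({1, -1} : Finset ℝ)), 4 * (S.filter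
      (fun z => 0 ≤ st.1 * (z.1.1 - z.1.2.1) ∧ 0 ≤ st.2 * (z.2.1 - z.2.2.1))).card <
      ∑ st ∈ (({1, -1} : Finset ℝ) ×ˢ ({1, -1} : Finset ℝ)), S.card := by
    apply sum_lt_sum_of_nonempty hne
    rintro ⟨s, t⟩ hst
    simp only [mem_product, mem_insert, mem_singleton] at hst
    exact hcon s t hst.1 hst.2
  rw [← mul_sum, sum_const, smul_eq_mul, card_product] at h2
  have : ({1, -1} : Finset ℝ).card ≤ 2 := card_le_two
  have h5 : ({1, -1} : Finset ℝ).card * ({1, -1} : Finset ℝ).card ≤ 4 := by nlinarith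
  have h6 := Nat.mul_le_mul_right S.card h5
  omega

/-- curve associated with a pair -/
noncomputable def gam (s t : ℝ) (r : (ℝ × ℝ) × (ℝ × ℝ)) : ℝ × ℝ × ℝ :=
  (s * r.1.1, t * r.2.1, r.1.2 ^ 2 - r.2.2 ^ 2)

lemma sgn_sq {s : ℝ} (hs : s = 1 ∨ s = -1) : s * s = 1 := by rcases hs with rfl | rfl <;> norm_num

lemma quads_curves (X : Finset ℝ) (P : Finset (ℝ × ℝ)) (s t : ℝ) (hs : s = 1 ∨ s = -1)
    (ht : t = 1 ∨ t = -1) :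
    (((quads X P).filter (fun z => z.2.2.2 ^ 2 < z.1.2.2 ^ 2)).filter
        (fun z => 0 ≤ s * (z.1.1 - z.1.2.1) ∧ 0 ≤ t * (z.2.1 - z.2.2.1))).card ≤
    ∑ r ∈ (P ×ˢ P).filter (fun r => r.2.2 ^ 2 < r.1.2 ^ 2),
      (hypS (X.image (fun x => s * x)) (X.image (fun x => t * x)) (gam s t r)).card := by
  classical
  set S := ((quads X P).filter (fun z => z.2.2.2 ^ 2 < z.1.2.2 ^ 2)).filter
        (fun z => 0 ≤ s * (z.1.1 - z.1.2.1) ∧ 0 ≤ t * (z.2.1 - z.2.2.1)) with hS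
  set R := (P ×ˢ P).filter (fun r => r.2.2 ^ 2 < r.1.2 ^ 2) with hR
  have hs2 := sgn_sq hs
  have ht2 := sgn_sq ht
  rw [card_eq_sum_card_fiberwise (f := fun z => (z.1.2, z.2.2)) (t := R)]
  · apply sum_le_sum
    rintro ⟨p, q⟩ hr
    have hpq : q.2 ^ 2 < p.2 ^ 2 := (mem_filter.1 hr).2
    -- key relation
    have key : ∀ z ∈ S.filter (fun z => (z.1.2, z.2.2) = (p, q)),
        hyp (gam s t (p, q)) (s * z.1.1) = t * z.2.1 := by
      rintro ⟨⟨x, p'⟩, ⟨w, q'⟩⟩ hz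
      simp only [hS, quads, mem_filter, mem_product, Prod.mk.injEq] at hz
      simp only [kap] at hz
      obtain ⟨⟨⟨⟨hm, hk⟩, hlt⟩, h1, h2⟩, rfl, rfl⟩ := hz
      simp only [hyp, gam]
      have : (s * x - s * p'.1) ^ 2 + (p'.2 ^ 2 - q'.2 ^ 2) = (t * (w - q'.1)) ^ 2 := by
        linear_combination hk + (x - p'.1) ^ 2 * hs2 - (w - q'.1) ^ 2 * ht2
      rw [this, Real.sqrt_sq h2]
      ring
    apply card_le_card_of_injOn (fun z => s * z.1.1)
    · intro z hz
      have hk := key z hz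
      have hz' := hz
      simp only [hS, quads, coe_filter, mem_filter, mem_product, Prod.mk.injEq, Set.mem_ofPred_eq] at hz'
      obtain ⟨⟨⟨⟨hm, _⟩, hlt⟩, h1, h2⟩, hp, hq⟩ := hz'
      simp only [hypS, coe_filter, Set.mem_ofPred_eq, mem_image]
      refine ⟨⟨_, hm.1.1, rfl⟩, ?_, ?_⟩
      · rw [hp] at h1
        simp only [gam]
        linarith
      · rw [hk]; exact ⟨_, hm.2.1, rfl⟩
    · intro z hz z' hz' h
      have e1 := key z hz
      have e2 := key z' hz'
      have hc := (mem_filter.1 hz).2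
      have hc' := (mem_filter.1 hz').2
      simp only at h
      rw [h] at e1
      have h3 : t * z.2.1 = t * z'.2.1 := by rw [← e1, ← e2]
      have a1 : z.1.1 = z'.1.1 := by linear_combination s * h + (z'.1.1 - z.1.1) * hs2
      have a2 : z.2.1 = z'.2.1 := by linear_combination t * h3 + (z'.2.1 - z.2.1) * ht2
      simp only [Prod.mk.injEq] at hc hc'
      refine Prod.ext (Prod.ext a1 ?_) (Prod.ext a2 ?_)
      · rw [hc.1, hc'.1]
      · rw [hc.2, hc'.2]
  · intro z hz
    simp only [hS, quads, coe_filter, mem_filter, mem_product, Set.mem_ofPred_eq] at hz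
    simp only [hR, coe_filter, mem_product, Set.mem_ofPred_eq]
    exact ⟨⟨hz.1.1.1.1.2, hz.1.1.1.2.2⟩, hz.1.2⟩

/-- popular values of a map -/
noncomputable def pop {α β : Type} [DecidableEq β] (S : Finset α) (f : α → β) (c F : ℕ) : Finset β :=
  (S.image f).filter (fun b => F ≤ c * (S.filter (fun a => f a = b)).card)

lemma pop_card {α β : Type} [DecidableEq β] (S : Finset α) (f : α → β) (c F : ℕ) :
    (pop S f c F).card * F ≤ c * S.card := by
  have h1 : (pop S f c F).card * F ≤ ∑ b ∈ pop S f c F, c * (S.filter (fun a => f a = b)).card := by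
    rw [← smul_eq_mul, ← sum_const]
    exact sum_le_sum (fun b hb => (mem_filter.1 hb).2)
  have h2 : ∑ b ∈ pop S f c F, c * (S.filter (fun a => f a = b)).card ≤
      ∑ b ∈ S.image f, c * (S.filter (fun a => f a = b)).card :=
    sum_le_sum_of_subset (filter_subset _ _)
  rw [← mul_sum (S.image f), ← card_eq_sum_card_image f S] at h2
  exact h1.trans h2

lemma mem_pop {α β : Type} [DecidableEq β] (S : Finset α) (f : α → β) (c F : ℕ) (hF : 0 < F) (b : β)
    (h : F ≤ c * (S.filter (fun a => f a = b)).card) : b ∈ pop S f c F := by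
  refine mem_filter.2 ⟨?_, h⟩
  have : (S.filter (fun a => f a = b)).Nonempty := by
    rw [nonempty_iff_ne_empty]
    intro h0
    rw [h0] at h
    simp at h
    omega
  obtain ⟨a, ha⟩ := this
  exact mem_image.2 ⟨a, (mem_filter.1 ha).1, (mem_filter.1 ha).2⟩

lemma exists_sgn (b y : ℝ) (h : y = b ^ 2) : ∃ e ∈ ({1, -1} : Finset ℝ), b = e * Real.sqrt y := by
  subst h
  rw [Real.sqrt_sq_eq_abs]
  rcases abs_choice b with h | h
  · exact ⟨1, by simp, by rw [h]; ring⟩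
  · exact ⟨-1, by simp, by rw [h]; ring⟩

lemma card_pm : ({1, -1} : Finset ℝ).card ≤ 2 := card_le_two

lemma mult_col1 (P : Finset (ℝ × ℝ)) (R : Finset ((ℝ × ℝ) × (ℝ × ℝ))) (hR : R ⊆ P ×ˢ P) (s t : ℝ)
    (hs : s = 1 ∨ s = -1) (ht : t = 1 ∨ t = -1) (γ : ℝ × ℝ × ℝ) :
    (R.filter (fun r => gam s t r = γ)).card ≤ 2 * (P.filter (fun p => s * p.1 = γ.1)).card := by
  classical
  have ht2 := sgn_sq ht
  have hsub : R.filter (fun r => gam s t r = γ) ⊆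
      ((P.filter (fun p => s * p.1 = γ.1)) ×ˢ ({1, -1} : Finset ℝ)).image
        (fun z => (z.1, (t * γ.2.1, z.2 * Real.sqrt (z.1.2 ^ 2 - γ.2.2)))) := by
    rintro ⟨p, q⟩ hr
    rw [mem_filter] at hr
    have hPP := mem_product.1 (hR hr.1)
    obtain ⟨h1, h2⟩ := hr
    subst h2
    obtain ⟨e, he, he'⟩ := exists_sgn q.2 (p.2 ^ 2 - (gam s t (p, q)).2.2) (by simp [gam])
    refine mem_image.2 ⟨(p, e), mem_product.2 ⟨mem_filter.2 ⟨hPP.1, rfl⟩, he⟩, ?_⟩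
    refine Prod.ext rfl (Prod.ext ?_ he'.symm)
    simp only [gam]
    linear_combination q.1 * ht2
  refine (card_le_card hsub).trans (card_image_le.trans ?_)
  rw [card_product, mul_comm]
  exact Nat.mul_le_mul_right _ card_pm

lemma mult_col2 (P : Finset (ℝ × ℝ)) (R : Finset ((ℝ × ℝ) × (ℝ × ℝ))) (hR : R ⊆ P ×ˢ P) (s t : ℝ)
    (hs : s = 1 ∨ s = -1) (ht : t = 1 ∨ t = -1) (γ : ℝ × ℝ × ℝ) :
    (R.filter (fun r => gam s t r = γ)).card ≤ 2 * (P.filter (fun p => t * p.1 = γ.2.1)).card := by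
  classical
  have hs2 := sgn_sq hs
  have hsub : R.filter (fun r => gam s t r = γ) ⊆
      ((P.filter (fun p => t * p.1 = γ.2.1)) ×ˢ ({1, -1} : Finset ℝ)).image
        (fun z => ((s * γ.1, z.2 * Real.sqrt (z.1.2 ^ 2 + γ.2.2)), z.1)) := by
    rintro ⟨p, q⟩ hr
    rw [mem_filter] at hr
    have hPP := mem_product.1 (hR hr.1)
    obtain ⟨h1, h2⟩ := hr
    subst h2
    obtain ⟨e, he, he'⟩ := exists_sgn p.2 (q.2 ^ 2 + (gam s t (p, q)).2.2) (by simp [gam])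
    refine mem_image.2 ⟨(q, e), mem_product.2 ⟨mem_filter.2 ⟨hPP.2, rfl⟩, he⟩, ?_⟩
    refine Prod.ext (Prod.ext ?_ he'.symm) rfl
    simp only [gam]
    linear_combination p.1 * hs2
  refine (card_le_card hsub).trans (card_image_le.trans ?_)
  rw [card_product, mul_comm]
  exact Nat.mul_le_mul_right _ card_pm

lemma mult_diff (P : Finset (ℝ × ℝ)) (R : Finset ((ℝ × ℝ) × (ℝ × ℝ))) (hR : R ⊆ P ×ˢ P) (s t : ℝ)
    (hs : s = 1 ∨ s = -1) (ht : t = 1 ∨ t = -1) (γ : ℝ × ℝ × ℝ) :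
    (R.filter (fun r => gam s t r = γ)).card ≤
      4 * (((P.image (fun p => p.2 ^ 2)) ×ˢ (P.image (fun p => p.2 ^ 2))).filter
        (fun y => y.1 - y.2 = γ.2.2)).card := by
  classical
  have hs2 := sgn_sq hs
  have ht2 := sgn_sq ht
  set Y := P.image (fun p => p.2 ^ 2) with hY
  have hsub : R.filter (fun r => gam s t r = γ) ⊆
      (((Y ×ˢ Y).filter (fun y => y.1 - y.2 = γ.2.2)) ×ˢ
        (({1, -1} : Finset ℝ) ×ˢ ({1, -1} : Finset ℝ))).image
        (fun z => ((s * γ.1, z.2.1 * Real.sqrt z.1.1), (t * γ.2.1, z.2.2 * Real.sqrt z.1.2))) := by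
    rintro ⟨p, q⟩ hr
    rw [mem_filter] at hr
    have hPP := mem_product.1 (hR hr.1)
    obtain ⟨h1, h2⟩ := hr
    subst h2
    obtain ⟨e, he, he'⟩ := exists_sgn p.2 (p.2 ^ 2) rfl
    obtain ⟨f, hf, hf'⟩ := exists_sgn q.2 (q.2 ^ 2) rfl
    refine mem_image.2 ⟨((p.2 ^ 2, q.2 ^ 2), (e, f)), mem_product.2 ⟨mem_filter.2
      ⟨mem_product.2 ⟨?_, ?_⟩, rfl⟩, mem_product.2 ⟨he, hf⟩⟩, ?_⟩
    · exact mem_image_of_mem (fun p : ℝ × ℝ => p.2 ^ 2) hPP.1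
    · exact mem_image_of_mem (fun p : ℝ × ℝ => p.2 ^ 2) hPP.2
    · refine Prod.ext (Prod.ext ?_ he'.symm) (Prod.ext ?_ hf'.symm)
      · simp only [gam]
        linear_combination p.1 * hs2
      · simp only [gam]
        linear_combination q.1 * ht2
  refine (card_le_card hsub).trans (card_image_le.trans ?_)
  rw [card_product, card_product, mul_comm]
  apply Nat.mul_le_mul_right
  exact Nat.mul_le_mul card_pm card_pm

lemma diff_le (Y : Finset ℝ) (τ : ℝ) : ((Y ×ˢ Y).filter (fun y => y.1 - y.2 = τ)).card ≤ Y.card := by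
  apply card_le_card_of_injOn Prod.fst
  · intro y hy
    exact (mem_product.1 (mem_filter.1 hy).1).1
  · intro y hy z hz h
    have h1 := (mem_filter.1 hy).2
    have h2 := (mem_filter.1 hz).2
    exact Prod.ext h (by linarith)

theorem setupE (X : Finset ℝ) (P : Finset (ℝ × ℝ)) (D : Finset ℝ)
    (hD : ∀ x ∈ X, ∀ p ∈ P, (x - p.1) ^ 2 + p.2 ^ 2 ∈ D)
    (hn : 5 * D.card ≤ P.card) (hP : 0 < P.card) (hX : 0 < X.card) (M₀ L : ℕ)
    (hM : 16 * P.card * M₀ ≤ X.card ^ 2) (hL : P.card ^ 2 < 2 ^ L) :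
    ∃ (X₁ X₂ : Finset ℝ) (Γ : Finset (ℝ × ℝ × ℝ)) (A₁ A₂ 𝒯 : Finset ℝ) (F : ℕ),
      X₁.card ≤ X.card ∧ X₂.card ≤ X.card ∧ 0 < F ∧
      F ≤ 4 * (P.image (fun p => p.2 ^ 2)).card ∧
      (∀ γ ∈ Γ, 0 < γ.2.2 ∧ γ.1 ∈ A₁ ∧ γ.2.1 ∈ A₂ ∧ γ.2.2 ∈ 𝒯) ∧
      (∀ γ ∈ Γ, M₀ ≤ (hypS X₁ X₂ γ).card) ∧
      A₁.card * F ≤ 2 * P.card ∧ A₂.card * F ≤ 2 * P.card ∧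
      𝒯.card * F ≤ 4 * (P.image (fun p => p.2 ^ 2)).card ^ 2 ∧
      X.card ^ 2 * P.card ≤ 32 * L * F * ∑ γ ∈ Γ, (hypS X₁ X₂ γ).card := by
  classical
  have h1 := quads_lt X P D hD hn hP
  obtain ⟨s, t, hs, ht, h2⟩ := quads_sign X P
  have h3 := quads_curves X P s t hs ht
  set R := (P ×ˢ P).filter (fun r => r.2.2 ^ 2 < r.1.2 ^ 2) with hR
  set X₁ := X.image (fun x => s * x) with hX₁
  set X₂ := X.image (fun x => t * x) with hX₂
  set f : ℝ × ℝ × ℝ → ℕ := fun γ => (hypS X₁ X₂ γ).card with hf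
  set Y := P.image (fun p => p.2 ^ 2) with hY
  set R' := R.filter (fun r => M₀ ≤ f (gam s t r)) with hR'
  have h4 : X.card ^ 2 * P.card ≤ 8 * ∑ r ∈ R, f (gam s t r) := by
    change _ ≤ ∑ r ∈ R, f (gam s t r) at h3
    omega
  have hRsub : R ⊆ P ×ˢ P := filter_subset _ _
  have hR'sub : R' ⊆ P ×ˢ P := (filter_subset _ _).trans hRsub
  have hRc : R.card ≤ P.card ^ 2 := (card_le_card hRsub).trans (by rw [card_product, sq])
  have h5 : X.card ^ 2 * P.card ≤ 16 * ∑ r ∈ R', f (gam s t r) := by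
    have hsplit := sum_filter_add_sum_filter_not R (fun r => M₀ ≤ f (gam s t r)) (fun r => f (gam s t r))
    have hsm : ∑ r ∈ R.filter (fun r => ¬ M₀ ≤ f (gam s t r)), f (gam s t r) ≤ P.card ^ 2 * M₀ := by
      calc _ ≤ ∑ r ∈ R.filter (fun r => ¬ M₀ ≤ f (gam s t r)), M₀ :=
            sum_le_sum (fun r hr => (not_le.1 (mem_filter.1 hr).2).le)
        _ = _ * M₀ := by rw [sum_const, smul_eq_mul]
        _ ≤ P.card ^ 2 * M₀ := Nat.mul_le_mul_right _ ((card_filter_le _ _).trans hRc)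
    have h6 : 16 * (P.card ^ 2 * M₀) ≤ X.card ^ 2 * P.card := by
      calc 16 * (P.card ^ 2 * M₀) = (16 * P.card * M₀) * P.card := by ring
        _ ≤ _ := Nat.mul_le_mul_right _ hM
    change ∑ r ∈ R', f (gam s t r) + _ = _ at hsplit
    omega
  set μ : ℝ × ℝ × ℝ → ℕ := fun γ => (R'.filter (fun r => gam s t r = γ)).card with hμ
  set Γ₀ := R'.image (gam s t) with hΓ₀
  have h6 : ∑ r ∈ R', f (gam s t r) = ∑ γ ∈ Γ₀, μ γ * f γ := by
    rw [← sum_fiberwise_of_maps_to (g := gam s t) (t := Γ₀) (fun r hr => mem_image_of_mem _ hr)]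
    apply sum_congr rfl
    intro γ hγ
    rw [sum_congr rfl (g := fun _ => f γ), sum_const, smul_eq_mul]
    intro r hr
    rw [(mem_filter.1 hr).2]
  have hμ0 : ∀ γ ∈ Γ₀, μ γ ≠ 0 := by
    intro γ hγ
    obtain ⟨r, hr, rfl⟩ := mem_image.1 hγ
    have hne : (R'.filter (fun r' => gam s t r' = gam s t r)).Nonempty := ⟨r, mem_filter.2 ⟨hr, rfl⟩⟩
    exact (card_pos.2 hne).ne'
  have hμL : ∀ γ ∈ Γ₀, Nat.log 2 (μ γ) < L := by
    intro γ hγ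
    apply Nat.log_lt_of_lt_pow (hμ0 γ hγ)
    refine lt_of_le_of_lt ?_ hL
    exact (card_filter_le _ _).trans ((card_filter_le _ _).trans hRc)
  have h7 : ∑ γ ∈ Γ₀, μ γ * f γ = ∑ k ∈ range L, ∑ γ ∈ Γ₀.filter (fun γ => Nat.log 2 (μ γ) = k), μ γ * f γ := by
    rw [sum_fiberwise_of_maps_to]
    intro γ hγ
    exact mem_range.2 (hμL γ hγ)
  have hpos : 0 < X.card ^ 2 * P.card := by positivity
  have hLpos : 0 < L := by
    rcases Nat.eq_zero_or_pos L with h | h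
    · rw [h] at hL
      have : 0 < P.card ^ 2 := by positivity
      omega
    · exact h
  obtain ⟨k, hk, h8⟩ : ∃ k ∈ range L, ∑ γ ∈ Γ₀, μ γ * f γ ≤
      L * ∑ γ ∈ Γ₀.filter (fun γ => Nat.log 2 (μ γ) = k), μ γ * f γ := by
    by_contra hcon
    push Not at hcon
    have := sum_lt_sum_of_nonempty (nonempty_range_iff.2 hLpos.ne') hcon
    rw [← mul_sum, ← h7, sum_const, smul_eq_mul, card_range] at this
    omega
  set Γ := Γ₀.filter (fun γ => Nat.log 2 (μ γ) = k) with hΓ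
  have hlow : ∀ γ ∈ Γ, 2 ^ k ≤ μ γ := by
    intro γ hγ
    have h := mem_filter.1 hγ
    rw [← h.2]
    exact Nat.pow_log_le_self 2 (hμ0 γ h.1)
  have hhigh : ∀ γ ∈ Γ, μ γ ≤ 2 * 2 ^ k := by
    intro γ hγ
    have h := mem_filter.1 hγ
    have := Nat.lt_pow_succ_log_self (b := 2) (by norm_num) (μ γ)
    rw [h.2, pow_succ] at this
    omega
  have h9 : ∑ γ ∈ Γ, μ γ * f γ ≤ 2 * 2 ^ k * ∑ γ ∈ Γ, f γ := by
    rw [mul_sum]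
    exact sum_le_sum (fun γ hγ => Nat.mul_le_mul_right _ (hhigh γ hγ))
  have hfin : X.card ^ 2 * P.card ≤ 32 * L * 2 ^ k * ∑ γ ∈ Γ, f γ := by
    calc X.card ^ 2 * P.card ≤ 16 * ∑ r ∈ R', f (gam s t r) := h5
      _ ≤ 16 * (L * (2 * 2 ^ k * ∑ γ ∈ Γ, f γ)) := by
          rw [h6]
          gcongr
          exact h8.trans (by gcongr)
      _ = _ := by ring
  have hk0 : 0 < 2 ^ k := by positivity
  refine ⟨X₁, X₂, Γ, pop P (fun p => s * p.1) 2 (2 ^ k), pop P (fun p => t * p.1) 2 (2 ^ k),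
    pop (Y ×ˢ Y) (fun y => y.1 - y.2) 4 (2 ^ k), 2 ^ k, card_image_le, card_image_le, hk0, ?_, ?_, ?_,
    pop_card _ _ _ _, pop_card _ _ _ _, ?_, hfin⟩
  · have : Γ.Nonempty := by
      rw [nonempty_iff_ne_empty]
      intro h0
      rw [h0] at hfin
      simp at hfin
      rcases hfin with h | h
      · rw [h] at hX; simp at hX
      · rw [h] at hP; simp at hP
    obtain ⟨γ, hγ⟩ := this
    exact (hlow γ hγ).trans ((mult_diff P R' hR'sub s t hs ht γ).trans
      (Nat.mul_le_mul_left _ (diff_le _ _)))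
  · intro γ hγ
    refine ⟨?_, ?_, ?_, ?_⟩
    · obtain ⟨r, hr, rfl⟩ := mem_image.1 (mem_filter.1 hγ).1
      have := (mem_filter.1 (mem_filter.1 hr).1).2
      simp only [gam]
      linarith
    · exact mem_pop _ _ _ _ hk0 _ ((hlow γ hγ).trans (mult_col1 P R' hR'sub s t hs ht γ))
    · exact mem_pop _ _ _ _ hk0 _ ((hlow γ hγ).trans (mult_col2 P R' hR'sub s t hs ht γ))
    · exact mem_pop _ _ _ _ hk0 _ ((hlow γ hγ).trans (mult_diff P R' hR'sub s t hs ht γ))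
  · intro γ hγ
    obtain ⟨r, hr, rfl⟩ := mem_image.1 (mem_filter.1 hγ).1
    exact (mem_filter.1 hr).2
  · have := pop_card (Y ×ˢ Y) (fun y : ℝ × ℝ => y.1 - y.2) 4 (2 ^ k)
    rwa [card_product, ← sq] at this

theorem contraE (X : Finset ℝ) (P : Finset (ℝ × ℝ)) (D : Finset ℝ)
    (hD : ∀ x ∈ X, ∀ p ∈ P, (x - p.1) ^ 2 + p.2 ^ 2 ∈ D)
    (hn : 5 * D.card ≤ P.card) (hP : 0 < P.card) (hX : 0 < X.card)
    (M₀ M G Ga Gt d L W H : ℕ)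
    (hM : 16 * P.card * M₀ ≤ X.card ^ 2) (hL : P.card ^ 2 < 2 ^ L)
    (hG : 0 < G) (hGa : 0 < Ga) (hGt : 0 < Gt)
    (hMG : 2 * (X.card / G + X.card / G + 3) ≤ M₀) (hMM : 2 * M ≤ M₀) (hM4 : 4 ≤ M)
    (hd : (Ga * Ga * Gt) ^ 2 ≤ 2 ^ d) (hMd : 64 * (Ga * Ga * Gt) * d ^ 2 ≤ M ^ 2)
    (hH : (P.image (fun p => p.2 ^ 2)).card ≤ H)
    (hWa : 2 * P.card ≤ W * Ga) (hWt : 4 * H ^ 2 ≤ W * Gt) (hWH : 4 * H ≤ W) :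
    P.card ≤ 512 * L * W * G ^ 2 := by
  obtain ⟨X₁, X₂, Γ, A₁, A₂, 𝒯, F, hX₁, hX₂, hF, hFh, hΓ, hΓM, hA₁, hA₂, h𝒯, hfin⟩ :=
    setupE X P D hD hn hP hX M₀ L hM hL
  have hE := hyperE X₁ X₂ Γ A₁ A₂ 𝒯 hΓ M₀ M G Ga Gt d hΓM hG hGa hGt
    (le_trans (by gcongr) hMG) hMM hM4 hd hMd
  have aux : ∀ A g B : ℕ, 0 < g → A * F ≤ B → B ≤ W * g → A / g * F ≤ W := by
    intro A g B hg h1 h2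
    have h3 : A / g * F * g ≤ W * g := by
      calc A / g * F * g = (A / g * g) * F := by ring
        _ ≤ A * F := Nat.mul_le_mul_right _ (Nat.div_mul_le_self A g)
        _ ≤ _ := h1.trans h2
    exact Nat.le_of_mul_le_mul_right h3 hg
  have a1 := aux A₁.card Ga _ hGa hA₁ hWa
  have a2 := aux A₂.card Ga _ hGa hA₂ hWa
  have a3 := aux 𝒯.card Gt _ hGt (h𝒯.trans (by gcongr : 4 * _ ^ 2 ≤ 4 * H ^ 2)) hWt
  have a4 : (A₁.card / Ga + A₂.card / Ga + 𝒯.card / Gt + 1) * F ≤ 4 * W := by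
    have : F ≤ W := hFh.trans ((Nat.mul_le_mul_left 4 hH).trans hWH)
    calc _ = A₁.card / Ga * F + A₂.card / Ga * F + 𝒯.card / Gt * F + F := by ring
      _ ≤ _ := by omega
  have h1 : X.card ^ 2 * P.card ≤ X.card ^ 2 * (512 * L * W * G ^ 2) := by
    calc X.card ^ 2 * P.card ≤ 32 * L * F * ∑ γ ∈ Γ, (hypS X₁ X₂ γ).card := hfin
      _ ≤ 32 * L * F * (4 * (A₁.card / Ga + A₂.card / Ga + 𝒯.card / Gt + 1) *
            (X₁.card * G * (X₂.card * G))) := by gcongr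
      _ ≤ 32 * L * F * (4 * (A₁.card / Ga + A₂.card / Ga + 𝒯.card / Gt + 1) *
            (X.card * G * (X.card * G))) := by gcongr
      _ = 128 * L * ((A₁.card / Ga + A₂.card / Ga + 𝒯.card / Gt + 1) * F) * (X.card * G) ^ 2 := by ring
      _ ≤ 128 * L * (4 * W) * (X.card * G) ^ 2 := by gcongr
      _ = _ := by ring
  exact Nat.le_of_mul_le_mul_left h1 (by positivity)

theorem boundB (X : Finset ℝ) (P : Finset (ℝ × ℝ)) (D : Finset ℝ)
    (hD : ∀ x ∈ X, ∀ p ∈ P, (x - p.1) ^ 2 + p.2 ^ 2 ∈ D)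
    (hn5 : 5 * D.card ≤ P.card) (n m h K d : ℕ) (hn : P.card = n) (hm : X.card = m)
    (hh : (P.image (fun p => p.2 ^ 2)).card = h)
    (hK1 : n ≤ K * m) (hmn : m ≤ n) (hK5 : K ^ 5 ≤ 32 * n) (hm75 : 75 ≤ m)
    (hd1 : 1 ≤ d) (hd : (1282 * K ^ 3 * n) ^ 2 ≤ 2 ^ d) :
    h ≤ 2 ^ 40 * d ^ 2 * K ^ 3 := by
  by_contra hcon
  push Not at hcon
  have hn0 : 0 < n := by omega
  have hm0 : 0 < m := by omega
  have hK0 : 0 < K := by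
    rcases Nat.eq_zero_or_pos K with h | h
    · rw [h] at hK1; omega
    · exact h
  have hhn : h ≤ n := by rw [← hh, ← hn]; exact card_image_le
  have hh0 : 0 < h := by omega
  obtain ⟨G₁, hG₁⟩ : ∃ G₁, G₁ = 641 * K ^ 3 := ⟨_, rfl⟩
  have hG₁0 : 0 < G₁ := by rw [hG₁]; positivity
  have hG₁h : G₁ ≤ h := by
    have h1 : 1 * (641 * K ^ 3) ≤ d ^ 2 * (2 ^ 40 * K ^ 3) := by
      have : 1 ≤ d ^ 2 := Nat.one_le_pow _ _ hd1
      exact Nat.mul_le_mul this (Nat.mul_le_mul_right _ (by norm_num))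
    have h2 : d ^ 2 * (2 ^ 40 * K ^ 3) = 2 ^ 40 * d ^ 2 * K ^ 3 := by ring
    omega
  obtain ⟨W, hW⟩ : ∃ W, W = h / G₁ + 1 := ⟨_, rfl⟩
  have hW0 : 0 < W := by rw [hW]; exact Nat.succ_pos _
  have hWG : W * G₁ ≤ 2 * h := by
    have := Nat.div_mul_le_self h G₁
    rw [hW, add_mul]; omega
  have hWn : W ≤ n := by
    have h1 : W * 2 ≤ W * G₁ := Nat.mul_le_mul_left _ (by
      rw [hG₁]; have : 0 < K ^ 3 := by positivity
      omega)
    omega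
  have hhW : h ≤ W * G₁ := by
    have := Nat.lt_div_mul_add (a := h) hG₁0
    rw [hW, add_mul]; omega
  obtain ⟨G₂, hG₂⟩ : ∃ G₂, G₂ = n / W + 1 := ⟨_, rfl⟩
  have hG₂0 : 0 < G₂ := by rw [hG₂]; exact Nat.succ_pos _
  have hGW : G₂ * W ≤ 2 * n := by
    have := Nat.div_mul_le_self n W
    rw [hG₂, add_mul]; omega
  have hnW : n ≤ W * G₂ := by
    have := Nat.lt_div_mul_add (a := n) hW0
    rw [hG₂, mul_add, mul_comm W]; omega
  have hG₂h : G₂ * h ≤ 2 * n * G₁ := by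
    calc G₂ * h ≤ G₂ * (W * G₁) := by gcongr
      _ = G₂ * W * G₁ := by ring
      _ ≤ _ := by gcongr
  obtain ⟨M, hM⟩ : ∃ M, M = m / 10 := ⟨_, rfl⟩
  have hM20 : m ≤ 20 * M := by omega
  have hDG : 20 * (D.card / (4 * K)) ≤ m := by
    have h1 := Nat.div_mul_le_self D.card (4 * K)
    have h2 : K * (20 * (D.card / (4 * K))) ≤ K * m := by
      calc _ = 5 * (D.card / (4 * K) * (4 * K)) := by ring
        _ ≤ 5 * D.card := by gcongr
        _ ≤ _ := by omega
    exact Nat.le_of_mul_le_mul_left h2 hK0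
  have hG₂n : G₂ ≤ 2 * n := by
    have := Nat.div_le_self n W
    omega
  have hrow := rowsB X P D hD (card_pos.1 (by omega)) hn5 (4 * K) G₁ G₂ d M (by positivity) hG₁0 hG₂0
    (by rw [hm]; omega) (by omega)
    (by
      refine le_trans (Nat.pow_le_pow_left ?_ 2) hd
      calc G₁ * G₂ ≤ G₁ * (2 * n) := by gcongr
        _ = _ := by rw [hG₁]; ring)
    (by
      have hpos : 0 < h * (400 * K ^ 2) := by positivity
      refine Nat.le_of_mul_le_mul_right ?_ hpos
      calc 64 * (G₁ * G₂) * d ^ 2 * (h * (400 * K ^ 2))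
          = 25600 * G₁ * (G₂ * h) * d ^ 2 * K ^ 2 := by ring
        _ ≤ 25600 * G₁ * (2 * n * G₁) * d ^ 2 * K ^ 2 := by gcongr
        _ = 51200 * 641 ^ 2 * (K ^ 5) * K ^ 3 * n * d ^ 2 := by rw [hG₁]; ring
        _ ≤ 51200 * 641 ^ 2 * (32 * n) * K ^ 3 * n * d ^ 2 := by gcongr
        _ = (51200 * 641 ^ 2 * 32) * (d ^ 2 * K ^ 3 * n ^ 2) := by ring
        _ ≤ 2 ^ 40 * (d ^ 2 * K ^ 3 * n ^ 2) := Nat.mul_le_mul_right _ (by norm_num)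
        _ = (2 ^ 40 * d ^ 2 * K ^ 3) * n ^ 2 := by ring
        _ ≤ h * (K * (20 * M)) ^ 2 := by
            gcongr
            exact hK1.trans (Nat.mul_le_mul_left _ hM20)
        _ = _ := by ring)
  rw [hh, hn] at hrow
  have hs : h / G₁ + n / G₂ + 1 ≤ 3 * W := by
    have h1 : h / G₁ ≤ W := Nat.div_le_of_le_mul (by rw [mul_comm]; exact hhW)
    have h2 : n / G₂ ≤ W := Nat.div_le_of_le_mul (by rw [mul_comm]; exact hnW)
    omega
  have hfin : (h * n * K ^ 3 * m) * 16025 ≤ (h * n * K ^ 3 * m) * 15360 := by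
    calc (h * n * K ^ 3 * m) * 16025 = 25 * G₁ * (m * h * n) := by rw [hG₁]; ring
      _ ≤ 25 * G₁ * (20 * M * h * n) := by gcongr
      _ = 500 * G₁ * (M * h * n) := by ring
      _ ≤ 500 * G₁ * (8 * (h / G₁ + n / G₂ + 1) * (D.card * (4 * K) * (D.card * (4 * K)))) := by gcongr
      _ ≤ 500 * G₁ * (8 * (3 * W) * (D.card * (4 * K) * (D.card * (4 * K)))) := by gcongr
      _ = 480 * (W * G₁) * (5 * D.card) ^ 2 * 16 * K ^ 2 := by ring
      _ ≤ 480 * (2 * h) * n ^ 2 * 16 * K ^ 2 := by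
          gcongr
          rw [← hn]; exact hn5
      _ = 15360 * h * n * K ^ 2 * n := by ring
      _ ≤ 15360 * h * n * K ^ 2 * (K * m) := by gcongr
      _ = _ := by ring
  have hpos : 0 < h * n * K ^ 3 * m := by positivity
  have := Nat.le_of_mul_le_mul_left hfin hpos
  omega

theorem boundE (X : Finset ℝ) (P : Finset (ℝ × ℝ)) (D : Finset ℝ)
    (hD : ∀ x ∈ X, ∀ p ∈ P, (x - p.1) ^ 2 + p.2 ^ 2 ∈ D)
    (hn5 : 5 * D.card ≤ P.card) (n m K d : ℕ) (hn : P.card = n) (hm : X.card = m)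
    (hh : (P.image (fun p => p.2 ^ 2)).card ≤ 2 ^ 40 * d ^ 2 * K ^ 3)
    (hK1 : n ≤ K * m) (hmn : m ≤ n) (hm0 : 75 ≤ m)
    (hd1 : 1 ≤ d) (hd : n ^ 4 ≤ 2 ^ d) :
    n ^ 3 < 2 ^ 210 * d ^ 9 * K ^ 16 := by
  by_contra hcon
  push Not at hcon
  have hn0 : 0 < n := by omega
  have hK0 : 0 < K := by
    rcases Nat.eq_zero_or_pos K with h | h
    · rw [h] at hK1; omega
    · exact h
  have hd0 : 0 < d := hd1
  -- cube root consequence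
  have c1 : 2 ^ 68 * d ^ 3 * K ^ 5 ≤ n := by
    have : (2 ^ 68 * d ^ 3 * K ^ 5) ^ 3 ≤ n ^ 3 := by
      calc (2 ^ 68 * d ^ 3 * K ^ 5) ^ 3 = 2 ^ 204 * d ^ 9 * K ^ 15 := by ring
        _ ≤ 2 ^ 210 * d ^ 9 * K ^ 16 := by
          have e1 : K ^ 15 ≤ K ^ 16 := Nat.pow_le_pow_right hK0 (by norm_num)
          have e2 : 2 ^ 204 ≤ 2 ^ 210 := Nat.pow_le_pow_right (by norm_num) (by norm_num)
          exact Nat.mul_le_mul (Nat.mul_le_mul_right _ e2) e1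
        _ ≤ _ := hcon
    exact le_of_pow_le_pow_left₀ (by norm_num) (by positivity) this
  have c2 : 2 ^ 80 * d ^ 4 * K ^ 8 ≤ n ^ 2 := by
    have : (2 ^ 80 * d ^ 4 * K ^ 8) ^ 2 ≤ (n ^ 2) ^ 2 := by
      calc (2 ^ 80 * d ^ 4 * K ^ 8) ^ 2 = 2 ^ 160 * d ^ 8 * K ^ 16 := by ring
        _ ≤ 2 ^ 210 * d ^ 9 * K ^ 16 := by
          have e1 : d ^ 8 ≤ d ^ 9 := Nat.pow_le_pow_right hd0 (by norm_num)
          have e2 : 2 ^ 160 ≤ 2 ^ 210 := Nat.pow_le_pow_right (by norm_num) (by norm_num)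
          exact Nat.mul_le_mul_right _ (Nat.mul_le_mul e2 e1)
        _ ≤ n ^ 3 := hcon
        _ ≤ n ^ 4 := Nat.pow_le_pow_right hn0 (by norm_num)
        _ = _ := by ring
    exact le_of_pow_le_pow_left₀ (by norm_num) (by positivity) this
  have c3 : 2 ^ 20 * K ^ 2 ≤ n := by
    have e1 : K ^ 2 ≤ K ^ 5 := Nat.pow_le_pow_right hK0 (by norm_num)
    have e2 : 2 ^ 20 * 1 ≤ 2 ^ 68 * d ^ 3 := Nat.mul_le_mul (by norm_num) (Nat.one_le_pow _ _ hd1)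
    calc 2 ^ 20 * K ^ 2 = 2 ^ 20 * 1 * K ^ 2 := by ring
      _ ≤ 2 ^ 68 * d ^ 3 * K ^ 5 := Nat.mul_le_mul e2 e1
      _ ≤ _ := c1
  have hmK : 128 * K ≤ m := by
    have : K * (128 * K) ≤ K * m := by
      calc K * (128 * K) = 128 * K ^ 2 := by ring
        _ ≤ 2 ^ 20 * K ^ 2 := Nat.mul_le_mul_right _ (by norm_num)
        _ ≤ _ := c3.trans hK1
    exact Nat.le_of_mul_le_mul_left this hK0
  obtain ⟨M₀, hM₀⟩ : ∃ M₀, M₀ = m / (16 * K) := ⟨_, rfl⟩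
  have hM₀8 : 8 ≤ M₀ := by
    rw [hM₀, Nat.le_div_iff_mul_le (by positivity)]
    omega
  have hM₀u : M₀ * (16 * K) ≤ m := by rw [hM₀]; exact Nat.div_mul_le_self _ _
  have hM₀l : m ≤ 32 * K * M₀ := by
    have h1 := Nat.lt_div_mul_add (a := m) (b := 16 * K) (by positivity)
    rw [← hM₀] at h1
    have h2 : 1 * (16 * K) ≤ M₀ * (16 * K) := Nat.mul_le_mul_right _ (by omega)
    have h3 : 32 * K * M₀ = 2 * (M₀ * (16 * K)) := by ring
    omega
  obtain ⟨M, hM⟩ : ∃ M, M = M₀ / 2 := ⟨_, rfl⟩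
  have hnM : n ≤ 96 * K ^ 2 * M := by
    calc n ≤ K * m := hK1
      _ ≤ K * (32 * K * M₀) := by gcongr
      _ ≤ K * (32 * K * (3 * M)) := by gcongr; omega
      _ = _ := by ring
  obtain ⟨B, hB⟩ : ∃ B, B = 2 ^ 27 * d * K ^ 2 := ⟨_, rfl⟩
  have hB0 : 0 < B := by rw [hB]; positivity
  obtain ⟨H, hH⟩ : ∃ H, H = 2 ^ 40 * d ^ 2 * K ^ 3 := ⟨_, rfl⟩
  have hH0 : 0 < H := by rw [hH]; positivity
  obtain ⟨W, hW⟩ : ∃ W, W = n / (2 ^ 26 * d * K ^ 2) := ⟨_, rfl⟩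
  have hW4 : 4 * H ≤ W := by
    rw [hW, Nat.le_div_iff_mul_le (by positivity), hH]
    calc 4 * (2 ^ 40 * d ^ 2 * K ^ 3) * (2 ^ 26 * d * K ^ 2) = 2 ^ 68 * d ^ 3 * K ^ 5 := by ring
      _ ≤ n := c1
  have hW0 : 0 < W := by omega
  have hWu : W * (2 ^ 26 * d * K ^ 2) ≤ n := by rw [hW]; exact Nat.div_mul_le_self _ _
  have hWB : n ≤ W * B := by
    have h1 := Nat.lt_div_mul_add (a := n) (b := 2 ^ 26 * d * K ^ 2) (by positivity)
    rw [← hW] at h1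
    have h2 : 1 * (2 ^ 26 * d * K ^ 2) ≤ W * (2 ^ 26 * d * K ^ 2) := Nat.mul_le_mul_right _ hW0
    have h3 : W * B = 2 * (W * (2 ^ 26 * d * K ^ 2)) := by rw [hB]; ring
    omega
  obtain ⟨Gt, hGt⟩ : ∃ Gt, Gt = 4 * H ^ 2 / W + 1 := ⟨_, rfl⟩
  have hGtu : W * Gt ≤ 4 * H ^ 2 + W := by
    have := Nat.div_mul_le_self (4 * H ^ 2) W
    rw [hGt, mul_add, mul_comm W]; omega
  have hGtl : 4 * H ^ 2 ≤ W * Gt := by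
    have := Nat.lt_div_mul_add (a := 4 * H ^ 2) hW0
    rw [hGt, mul_add, mul_comm W]; omega
  have hMd : 64 * ((2 * B) * (2 * B) * Gt) * d ^ 2 ≤ M ^ 2 := by
    have hpos : 0 < (96 * K ^ 2) ^ 2 * W * B := by positivity
    refine Nat.le_of_mul_le_mul_right ?_ hpos
    have q1 : 2 ^ 23 * B ^ 2 * d ^ 2 * K ^ 4 ≤ n ^ 2 := by
      calc 2 ^ 23 * B ^ 2 * d ^ 2 * K ^ 4 = 2 ^ 77 * (d ^ 4 * K ^ 8) := by rw [hB]; ring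
        _ ≤ 2 ^ 80 * (d ^ 4 * K ^ 8) := Nat.mul_le_mul_right _ (by norm_num)
        _ = 2 ^ 80 * d ^ 4 * K ^ 8 := by ring
        _ ≤ _ := c2
    have q2 : 2 ^ 25 * B ^ 3 * d ^ 2 * K ^ 4 * H ^ 2 ≤ n ^ 3 := by
      calc 2 ^ 25 * B ^ 3 * d ^ 2 * K ^ 4 * H ^ 2 = 2 ^ 186 * (d ^ 9 * K ^ 16) := by rw [hB, hH]; ring
        _ ≤ 2 ^ 210 * (d ^ 9 * K ^ 16) := Nat.mul_le_mul_right _ (by norm_num)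
        _ = 2 ^ 210 * d ^ 9 * K ^ 16 := by ring
        _ ≤ _ := hcon
    have q3 : 2 * (2 ^ 22 * B ^ 3 * d ^ 2 * K ^ 4 * (4 * H ^ 2 + W)) ≤ 2 * (n ^ 2 * W * B) := by
      calc 2 * (2 ^ 22 * B ^ 3 * d ^ 2 * K ^ 4 * (4 * H ^ 2 + W))
          = 2 ^ 25 * B ^ 3 * d ^ 2 * K ^ 4 * H ^ 2 + (2 ^ 23 * B ^ 2 * d ^ 2 * K ^ 4) * B * W := by ring
        _ ≤ n ^ 3 + n ^ 2 * B * W := by gcongr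
        _ = n ^ 2 * n + n ^ 2 * B * W := by ring
        _ ≤ n ^ 2 * (W * B) + n ^ 2 * B * W := by gcongr
        _ = _ := by ring
    calc 64 * ((2 * B) * (2 * B) * Gt) * d ^ 2 * ((96 * K ^ 2) ^ 2 * W * B)
        = 2359296 * (B ^ 3 * d ^ 2 * K ^ 4 * (W * Gt)) := by ring
      _ ≤ 2 ^ 22 * (B ^ 3 * d ^ 2 * K ^ 4 * (4 * H ^ 2 + W)) := by
          apply Nat.mul_le_mul (by norm_num)
          gcongr
      _ = 2 ^ 22 * B ^ 3 * d ^ 2 * K ^ 4 * (4 * H ^ 2 + W) := by ring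
      _ ≤ n ^ 2 * W * B := by omega
      _ ≤ (96 * K ^ 2 * M) ^ 2 * W * B := by gcongr
      _ = _ := by ring
  have hMn : M ≤ n := by
    have : m / (16 * K) ≤ m := Nat.div_le_self _ _
    omega
  have hg : (2 * B) * (2 * B) * Gt ≤ n ^ 2 := by
    calc (2 * B) * (2 * B) * Gt = 1 * ((2 * B) * (2 * B) * Gt) * 1 := by ring
      _ ≤ 64 * ((2 * B) * (2 * B) * Gt) * d ^ 2 :=
          Nat.mul_le_mul (Nat.mul_le_mul_right _ (by norm_num)) (Nat.one_le_pow _ _ hd1)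
      _ ≤ M ^ 2 := hMd
      _ ≤ _ := Nat.pow_le_pow_left hMn 2
  have hfin := contraE X P D hD hn5 (by omega) (by omega) M₀ M (256 * K) (2 * B) Gt d d W H
    (by
      rw [hn, hm]
      calc 16 * n * M₀ ≤ 16 * (K * m) * M₀ := by gcongr
        _ = m * (M₀ * (16 * K)) := by ring
        _ ≤ m * m := by gcongr
        _ = _ := by ring)
    (by
      rw [hn]
      refine lt_of_lt_of_le ?_ hd
      exact Nat.pow_lt_pow_right (by omega) (by norm_num))
    (by positivity) (by positivity) (by rw [hGt]; exact Nat.succ_pos _)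
    (by
      have : m / (256 * K) = M₀ / 16 := by
        rw [hM₀, Nat.div_div_eq_div_mul]
        congr 1; ring
      rw [hm, this]
      omega)
    (by omega) (by omega)
    ((Nat.pow_le_pow_left hg 2).trans (by rw [← pow_mul]; exact hd)) hMd (by rw [hH]; exact hh)
    (by
      rw [hn]
      calc 2 * n ≤ 2 * (W * B) := by gcongr
        _ = _ := by ring) hGtl hW4
  rw [hn] at hfin
  have : 2 * n ≤ n * 1 := by
    calc 2 * n ≤ 2 * (512 * d * W * (256 * K) ^ 2) := by gcongr
      _ = W * (2 ^ 26 * d * K ^ 2) := by ring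
      _ ≤ n * 1 := by rw [mul_one]; exact hWu
  omega

lemma D_card (P : Finset (ℝ × ℝ)) :
    ((((P.filter (fun p => p.2 = 0)).image Prod.fst) ×ˢ P).image
      (fun z : ℝ × (ℝ × ℝ) => (z.1 - z.2.1) ^ 2 + z.2.2 ^ 2)).card ≤ distSet P := by
  classical
  set D := (((P.filter (fun p => p.2 = 0)).image Prod.fst) ×ˢ P).image
      (fun z : ℝ × (ℝ × ℝ) => (z.1 - z.2.1) ^ 2 + z.2.2 ^ 2) with hD
  have hfin : ({x : ℝ | ∃ p ∈ P, ∃ q ∈ P, x = edist2 p q}).Finite := by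
    apply ((P ×ˢ P).image (fun z => edist2 z.1 z.2)).finite_toSet.subset
    rintro x ⟨p, hp, q, hq, rfl⟩
    exact mem_coe.2 (mem_image.2 ⟨(p, q), mem_product.2 ⟨hp, hq⟩, rfl⟩)
  have hnn : ∀ y ∈ D, 0 ≤ y := by
    intro y hy
    obtain ⟨z, _, rfl⟩ := mem_image.1 hy
    positivity
  have hinj : Set.InjOn Real.sqrt (D : Set ℝ) := by
    intro a ha b hb h
    exact (Real.sqrt_inj (hnn a ha) (hnn b hb)).1 h
  rw [← card_image_of_injOn hinj, ← Set.ncard_coe_finset, distSet]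
  apply Set.ncard_le_ncard _ hfin
  intro y hy
  obtain ⟨v, hv, rfl⟩ := mem_image.1 (mem_coe.1 hy)
  obtain ⟨⟨x, q⟩, hz, rfl⟩ := mem_image.1 hv
  rw [mem_product] at hz
  obtain ⟨p, hp, hpx⟩ := mem_image.1 hz.1
  rw [mem_filter] at hp
  refine ⟨p, hp.1, q, hz.2, ?_⟩
  simp only at hpx
  simp only [edist2, hp.2, hpx]
  congr 1
  ring

lemma col_card (P : Finset (ℝ × ℝ)) (x₀ : ℝ) :
    (P.filter (fun p => p.1 = x₀)).card ≤ 2 * (P.image (fun p => p.2 ^ 2)).card := by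
  classical
  have hsub : P.filter (fun p => p.1 = x₀) ⊆
      (({1, -1} : Finset ℝ) ×ˢ (P.image (fun p => p.2 ^ 2))).image
        (fun z => (x₀, z.1 * Real.sqrt z.2)) := by
    intro p hp
    rw [mem_filter] at hp
    obtain ⟨e, he, he'⟩ := exists_sgn p.2 (p.2 ^ 2) rfl
    refine mem_image.2 ⟨(e, p.2 ^ 2), mem_product.2 ⟨he, ?_⟩, ?_⟩
    · exact mem_image_of_mem (fun p : ℝ × ℝ => p.2 ^ 2) hp.1
    · exact Prod.ext hp.2.symm he'.symm
  refine (card_le_card hsub).trans (card_image_le.trans ?_)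
  rw [card_product]
  exact Nat.mul_le_mul_right _ card_pm

theorem natBound (P : Finset (ℝ × ℝ)) (n m h d : ℕ) (hn : P.card = n)
    (hdist : 5 * distSet P ≤ n) (hm : (P.filter (fun p => p.2 = 0)).card = m)
    (hmn5 : n ^ 4 ≤ m ^ 5) (hn2 : 2000 ≤ n)
    (hh : (P.image (fun p => p.2 ^ 2)).card = h) (hd1 : 1 ≤ d) (hd : n ^ 20 ≤ 2 ^ d) :
    (h * m ^ 7) ^ 4 ≤ (2 ^ 200 * 2 ^ 198) * d ^ 17 * n ^ 25 := by
  classical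
  have hmn : m ≤ n := by rw [← hm, ← hn]; exact card_filter_le _ _
  have hm75 : 75 ≤ m := by
    by_contra hc
    push Not at hc
    have h1 : m ^ 5 ≤ 74 ^ 5 := Nat.pow_le_pow_left (by omega) 5
    have h2 : 2000 ^ 4 ≤ n ^ 4 := Nat.pow_le_pow_left hn2 4
    norm_num at h1 h2
    omega
  have hm0 : 0 < m := by omega
  obtain ⟨K, hK⟩ : ∃ K, K = n / m + 1 := ⟨_, rfl⟩
  have hK1 : n ≤ K * m := by
    have := Nat.lt_div_mul_add (a := n) hm0
    rw [hK, add_mul]; omega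
  have hK2 : K * m ≤ 2 * n := by
    have := Nat.div_mul_le_self n m
    rw [hK, add_mul]; omega
  have hKn : K ≤ 2 * n := by
    have := Nat.div_le_self n m
    omega
  have hK5 : K ^ 5 ≤ 32 * n := by
    have hpos : 0 < m ^ 5 := by positivity
    refine Nat.le_of_mul_le_mul_right ?_ hpos
    calc K ^ 5 * m ^ 5 = (K * m) ^ 5 := by ring
      _ ≤ (2 * n) ^ 5 := by gcongr
      _ = 32 * n * n ^ 4 := by ring
      _ ≤ _ := by gcongr
  set X := (P.filter (fun p => p.2 = 0)).image Prod.fst with hX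
  have hXc : X.card = m := by
    rw [hX, card_image_of_injOn, hm]
    intro p hp q hq h
    have h1 := (mem_filter.1 hp).2
    have h2 := (mem_filter.1 hq).2
    exact Prod.ext h (by rw [h1, h2])
  set D := (X ×ˢ P).image (fun z : ℝ × (ℝ × ℝ) => (z.1 - z.2.1) ^ 2 + z.2.2 ^ 2) with hD
  have hDc : D.card ≤ distSet P := D_card P
  have hDm : ∀ x ∈ X, ∀ p ∈ P, (x - p.1) ^ 2 + p.2 ^ 2 ∈ D := fun x hx p hp =>
    mem_image.2 ⟨(x, p), mem_product.2 ⟨hx, hp⟩, rfl⟩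
  have hD5 : 5 * D.card ≤ P.card := by omega
  have b1 := boundB X P D hDm hD5 n m h K d hn hXc hh hK1 hmn hK5 hm75 hd1 (by
    refine le_trans ?_ hd
    calc (1282 * K ^ 3 * n) ^ 2 ≤ (2000 * (2 * n) ^ 3 * n) ^ 2 := by gcongr; norm_num
      _ = 256000000 * n ^ 8 := by ring
      _ ≤ n ^ 12 * n ^ 8 := by
          apply Nat.mul_le_mul_right
          calc 256000000 ≤ 2000 ^ 12 := by norm_num
            _ ≤ _ := Nat.pow_le_pow_left hn2 12
      _ = _ := by ring)
  have b2 := boundE X P D hDm hD5 n m K d hn hXc (by rw [hh]; exact b1) hK1 hmn hm75 hd1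
    (le_trans (Nat.pow_le_pow_right (by omega) (by norm_num)) hd)
  have c1 : h * m ^ 3 ≤ 2 ^ 43 * d ^ 2 * n ^ 3 := by
    calc h * m ^ 3 ≤ 2 ^ 40 * d ^ 2 * K ^ 3 * m ^ 3 := by gcongr
      _ = 2 ^ 40 * d ^ 2 * (K * m) ^ 3 := by ring
      _ ≤ 2 ^ 40 * d ^ 2 * (2 * n) ^ 3 := by gcongr
      _ = _ := by ring
  have c2 : m ^ 16 ≤ 2 ^ 226 * d ^ 9 * n ^ 13 := by
    have hpos : 0 < n ^ 3 := by positivity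
    refine Nat.le_of_mul_le_mul_right ?_ hpos
    calc m ^ 16 * n ^ 3 ≤ m ^ 16 * (2 ^ 210 * d ^ 9 * K ^ 16) := by gcongr
      _ = 2 ^ 210 * d ^ 9 * (K * m) ^ 16 := by ring
      _ ≤ 2 ^ 210 * d ^ 9 * (2 * n) ^ 16 := by gcongr
      _ = _ := by ring
  calc (h * m ^ 7) ^ 4 = (h * m ^ 3) ^ 4 * m ^ 16 := by ring
    _ ≤ (2 ^ 43 * d ^ 2 * n ^ 3) ^ 4 * (2 ^ 226 * d ^ 9 * n ^ 13) := by gcongr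
    _ = _ := by ring

lemma d_bound (η : ℝ) (hη : 0 < η) (n : ℕ) (hn : 1 ≤ n) :
    ((20 * (Nat.log 2 n + 1) : ℕ) : ℝ) ≤ 20 * (2 / η + 1) * (n : ℝ) ^ η := by
  have hn' : (1 : ℝ) ≤ n := by exact_mod_cast hn
  have h1 : (1 : ℝ) ≤ (n : ℝ) ^ η := Real.one_le_rpow hn' hη.le
  have h2 : Real.log n ≤ (n : ℝ) ^ η / η := Real.log_le_rpow_div (by positivity) hη
  have h3 : (Nat.log 2 n : ℝ) * Real.log 2 ≤ Real.log n := by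
    rw [← Real.log_pow]
    apply Real.log_le_log (by positivity)
    exact_mod_cast Nat.pow_log_le_self 2 (by omega)
  have h4 : (0.5 : ℝ) ≤ Real.log 2 := by have := Real.log_two_gt_d9; linarith
  have h5 : (Nat.log 2 n : ℝ) ≤ 2 * ((n : ℝ) ^ η / η) := by
    have : (0 : ℝ) ≤ Nat.log 2 n := by positivity
    nlinarith
  push_cast
  have : 20 * (2 / η + 1) * (n : ℝ) ^ η = 20 * (2 * ((n : ℝ) ^ η / η) + (n : ℝ) ^ η) := by
    field_simp
  rw [this]
  linarith

theorem stmt18 (η : ℝ) (hη : 0 < η) :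
    ∃ C : ℝ, 0 < C ∧
      ∀ (P : Finset (ℝ × ℝ)) (n : ℕ), P.card = n →
        ((distSet P : ℝ) ≤ (n : ℝ) / 5) →
        ∀ m : ℕ, (P.filter (fun p => p.2 = 0)).card = m → (n : ℝ) ^ ((4:ℝ)/5) ≤ (m : ℝ) →
        ∀ x₀ : ℝ,
          (((P.filter (fun p => p.1 = x₀)).card : ℝ))
            ≤ C * ((n : ℝ) ^ ((25:ℝ)/4 + 8*η) / (m : ℝ) ^ 7 + (n : ℝ) / (m : ℝ)) := by
  have hB0 : 0 < 20 * (2 / η + 1) := by positivity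
  refine ⟨2 ^ 101 * (20 * (2 / η + 1)) ^ 5 + 2000, by positivity, ?_⟩
  intro P n hn hdist m hm hmn x₀
  have hT1 : 0 ≤ (n : ℝ) ^ ((25:ℝ)/4 + 8*η) / (m : ℝ) ^ 7 := by positivity
  have hT2 : 0 ≤ (n : ℝ) / (m : ℝ) := by positivity
  have hkn : (P.filter (fun p => p.1 = x₀)).card ≤ n := by rw [← hn]; exact card_filter_le _ _
  rcases Nat.eq_zero_or_pos n with h0 | hn0
  · have : (P.filter (fun p => p.1 = x₀)).card = 0 := by omega
    rw [this]
    simp only [Nat.cast_zero]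
    positivity
  have hn0' : (0 : ℝ) < n := by exact_mod_cast hn0
  have hm0' : (0 : ℝ) < m := lt_of_lt_of_le (by positivity) hmn
  have hmn' : m ≤ n := by rw [← hm, ← hn]; exact card_filter_le _ _
  rcases lt_or_ge n 2000 with hsm | hlg
  · have h1 : (1 : ℝ) ≤ (n : ℝ) / m := by
      rw [one_le_div hm0']; exact_mod_cast hmn'
    have h2 : ((P.filter (fun p => p.1 = x₀)).card : ℝ) ≤ 2000 := by
      exact_mod_cast (hkn.trans hsm.le)
    have h3 : 0 ≤ 2 ^ 101 * (20 * (2 / η + 1)) ^ 5 := by positivity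
    nlinarith [mul_nonneg h3 hT1, mul_nonneg h3 hT2]
  · set d := 20 * (Nat.log 2 n + 1) with hd
    set h := (P.image (fun p => p.2 ^ 2)).card with hh
    have hm5 : n ^ 4 ≤ m ^ 5 := by
      have h1 : ((n : ℝ) ^ ((4:ℝ)/5)) ^ 5 ≤ (m : ℝ) ^ 5 := by gcongr
      rw [← Real.rpow_natCast ((n : ℝ) ^ ((4:ℝ)/5)) 5, ← Real.rpow_mul hn0'.le] at h1
      norm_num at h1
      exact_mod_cast h1
    have h5 : 5 * distSet P ≤ n := by
      have : 5 * (distSet P : ℝ) ≤ n := by linarith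
      exact_mod_cast this
    have hb := natBound P n m h d hn h5 hm hm5 hlg rfl (by omega) (by
      rw [hd, mul_comm, pow_mul]
      exact Nat.pow_le_pow_left (Nat.lt_pow_succ_log_self (by norm_num) n).le 20)
    have hcol := col_card P x₀
    have hdb := d_bound η hη n hn0
    have hd1 : (1 : ℝ) ≤ d := by
      have : 1 ≤ d := by omega
      exact_mod_cast this
    set N : ℝ := (n : ℝ) ^ ((25:ℝ)/4) with hN
    have hN4 : N ^ 4 = (n : ℝ) ^ 25 := by
      rw [hN, ← Real.rpow_natCast, ← Real.rpow_mul hn0'.le]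
      norm_num
    have hN0 : 0 < N := by positivity
    have hb1 : (h : ℝ) * m ^ 7 ≤ 2 ^ 100 * d ^ 5 * N := by
      have hbr : ((h : ℝ) * m ^ 7) ^ 4 ≤ (2 ^ 200 * 2 ^ 198) * d ^ 17 * n ^ 25 := by exact_mod_cast hb
      refine le_of_pow_le_pow_left₀ (n := 4) (by norm_num) (by positivity) ?_
      calc ((h : ℝ) * m ^ 7) ^ 4 ≤ (2 ^ 200 * 2 ^ 198) * d ^ 17 * n ^ 25 := hbr
        _ ≤ (2 ^ 200 * 2 ^ 200) * d ^ 20 * n ^ 25 := by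
            gcongr
            all_goals first | exact hd1 | norm_num
        _ = _ := by rw [← hN4]; ring
    have hd5 : (d : ℝ) ^ 5 ≤ (20 * (2 / η + 1)) ^ 5 * (n : ℝ) ^ (8 * η) := by
      calc (d : ℝ) ^ 5 ≤ (20 * (2 / η + 1) * (n : ℝ) ^ η) ^ 5 := by gcongr
        _ = (20 * (2 / η + 1)) ^ 5 * ((n : ℝ) ^ η) ^ 5 := by ring
        _ ≤ _ := by
            apply mul_le_mul_of_nonneg_left _ (by positivity)
            rw [← Real.rpow_natCast ((n : ℝ) ^ η) 5, ← Real.rpow_mul hn0'.le]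
            apply Real.rpow_le_rpow_of_exponent_le
            · exact_mod_cast hn0
            · push_cast; linarith
    have hk : ((P.filter (fun p => p.1 = x₀)).card : ℝ) ≤ 2 * h := by exact_mod_cast hcol
    have hmain : ((P.filter (fun p => p.1 = x₀)).card : ℝ) ≤
        2 ^ 101 * (20 * (2 / η + 1)) ^ 5 * ((n : ℝ) ^ ((25:ℝ)/4 + 8*η) / (m : ℝ) ^ 7) := by
      rw [← mul_div_assoc, le_div_iff₀ (by positivity), Real.rpow_add hn0']
      calc ((P.filter (fun p => p.1 = x₀)).card : ℝ) * (m : ℝ) ^ 7 ≤ 2 * (h : ℝ) * (m : ℝ) ^ 7 := by gcongr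
        _ = 2 * ((h : ℝ) * (m : ℝ) ^ 7) := by ring
        _ ≤ 2 * (2 ^ 100 * (d : ℝ) ^ 5 * N) := by gcongr
        _ ≤ 2 * (2 ^ 100 * ((20 * (2 / η + 1)) ^ 5 * (n : ℝ) ^ (8 * η)) * N) := by gcongr
        _ = _ := by ring
    have h3 : 0 ≤ 2 ^ 101 * (20 * (2 / η + 1)) ^ 5 := by positivity
    nlinarith [mul_nonneg h3 hT2]
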